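/- arXiv:1807.09107 — 8 statements merged into one kernel-verified Lean document; each statement's English description precedes it below -/
import Mathlib

section
/- Let R be a finite commutative Frobenius ring with generating character χ. For every R-submodule X ⊆ R^{2n}, the dual module X^⊥ = {v ∈ R^{2n} : ⟨v,w⟩_s = 0 for all w ∈ X} equals {v ∈ R^{2n} : χ(⟨v,w⟩_s) = 1 for all w ∈ X}. -/
open Matrix

/-- A generating character of a finite commutative ring. -/
def IsGenChar {R : Type*} [CommRing R] [Fintype R] (χ : AddChar R ℂ) : Prop :=
  ∀ ψ : AddChar R ℂ, ∃ r : R, ∀ v : R, ψ v = χ (v * r)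

/-- The symplectic inner product on `R^{2n} = R^n × R^n`:
`⟨(a,b),(a',b')⟩ = b·a' − b'·a`. -/
def sympForm {R : Type*} [CommRing R] {n : ℕ}
    (v w : (Fin n → R) × (Fin n → R)) : R :=
  v.2 ⬝ᵥ w.1 - w.2 ⬝ᵥ v.1

theorem sympForm_smul_right {R : Type*} [CommRing R] {n : ℕ} (r : R)
    (v w : (Fin n → R) × (Fin n → R)) : sympForm v (r • w) = sympForm v w * r := by
  simp only [sympForm, Prod.smul_fst, Prod.smul_snd, dotProduct_smul, smul_dotProduct, smul_eq_mul]
  ring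

/-- The kernel of a generating character contains no nonzero ideal. -/
theorem IsGenChar.eq_zero_of_forall_mul {R : Type*} [CommRing R] [Fintype R] {χ : AddChar R ℂ}
    (hχ : IsGenChar χ) {a : R} (ha : ∀ r, χ (a * r) = 1) : a = 0 := by
  refine AddChar.forall_apply_eq_zero.1 fun ψ => ?_
  obtain ⟨r, hr⟩ := hχ ψ
  rw [hr, ha]

/-- For any submodule `X ⊆ R^{2n}`, the dual module
`X^⊥ = {v : ⟨v,w⟩ = 0 ∀ w ∈ X}` coincides with `{v : χ(⟨v,w⟩) = 1 ∀ w ∈ X}`. -/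
theorem stmt5 {R : Type*} [CommRing R] [Fintype R] {n : ℕ}
    (χ : AddChar R ℂ) (hχ : IsGenChar χ)
    (X : Submodule R ((Fin n → R) × (Fin n → R))) :
    {v : (Fin n → R) × (Fin n → R) | ∀ w ∈ X, sympForm v w = 0} =
      {v : (Fin n → R) × (Fin n → R) | ∀ w ∈ X, χ (sympForm v w) = 1} := by
  ext v
  refine ⟨fun h w hw => ?_, fun h w hw => hχ.eq_zero_of_forall_mul fun r => ?_⟩
  · rw [h w hw, AddChar.map_zero_eq_one]
  · rw [← sympForm_smul_right]
    exact h _ (X.smul_mem r hw)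
end

section
/- Let R be a finite commutative Frobenius ring with generating character χ. An R-submodule C ⊆ R^{2n} is a stabilizer code (i.e., C = Ψ(S) for some stabilizer S ≤ P_n) if and only if C is self-orthogonal with respect to the symplectic inner product, i.e., C ⊆ C^⊥. -/
open Matrix

/-- The shift operator `X(a)`:  `X(a) v_x = v_{x+a}`. -/
noncomputable def XM {R : Type*} [CommRing R] [Fintype R] [DecidableEq R] {n : ℕ}
    (a : Fin n → R) : Matrix (Fin n → R) (Fin n → R) ℂ :=
  fun y x => if y = x + a then 1 else 0

/-- The phase operator `Z(b)`:  `Z(b) v_x = χ(b·x) v_x`. -/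
noncomputable def ZM {R : Type*} [CommRing R] [Fintype R] [DecidableEq R] {n : ℕ}
    (χ : AddChar R ℂ) (b : Fin n → R) : Matrix (Fin n → R) (Fin n → R) ℂ :=
  Matrix.diagonal fun x => χ (b ⬝ᵥ x)

/-- The set `P_n = {ω^ℓ X(a)Z(b) : ℓ ∈ ℤ, a, b ∈ R^n}` of Pauli operators. -/
noncomputable def PauliSet {R : Type*} [CommRing R] [Fintype R] [DecidableEq R] {n : ℕ}
    (χ : AddChar R ℂ) (ω : ℂ) : Set (Matrix (Fin n → R) (Fin n → R) ℂ) :=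
  {M | ∃ (ℓ : ℤ) (a b : Fin n → R), M = ω ^ ℓ • (XM a * ZM χ b)}

/-- `S` is a stabilizer: an abelian subgroup of the Pauli group `P_n` meeting
the kernel `{ω^ℓ I}` of `Ψ` only in `I`. -/
noncomputable def IsStabilizer {R : Type*} [CommRing R] [Fintype R] [DecidableEq R] {n : ℕ}
    (χ : AddChar R ℂ) (ω : ℂ) (S : Set (Matrix (Fin n → R) (Fin n → R) ℂ)) : Prop :=
  S ⊆ PauliSet χ ω ∧
  (1 : Matrix (Fin n → R) (Fin n → R) ℂ) ∈ S ∧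
  (∀ P ∈ S, ∀ Q ∈ S, P * Q ∈ S) ∧
  (∀ P ∈ S, ∀ Q ∈ S, P * Q = Q * P) ∧
  (∀ P ∈ S, ∃ Q ∈ S, P * Q = 1) ∧
  (∀ P ∈ S, (∃ ℓ : ℤ, P = ω ^ ℓ • (1 : Matrix (Fin n → R) (Fin n → R) ℂ)) → P = 1)

/-- The image `Ψ(S) ⊆ R^{2n}` of a set of Pauli operators under `Ψ`. -/
noncomputable def PsiIm {R : Type*} [CommRing R] [Fintype R] [DecidableEq R] {n : ℕ}
    (χ : AddChar R ℂ) (ω : ℂ) (S : Set (Matrix (Fin n → R) (Fin n → R) ℂ)) :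
    Set ((Fin n → R) × (Fin n → R)) :=
  {p | ∃ ℓ : ℤ, ω ^ ℓ • (XM p.1 * ZM χ p.2) ∈ S}

/-- The underlying set of the central extension of `A` by the `N`-th roots of unity. -/
@[ext]
structure PhaseExt (A : Type*) (N : ℕ) where
  /-- The component in `A`. -/
  base : A
  /-- The phase. -/
  phase : rootsOfUnity N ℂ

namespace PhaseExt

variable {A : Type*} [AddCommGroup A] {N : ℕ}

/-- The commutative group structure on `PhaseExt A N` twisted by a symmetric biadditive map. -/
abbrev commGroup (B : A → A → rootsOfUnity N ℂ)
    (hB : ∀ a b c, B (a + b) c = B a c * B b c) (hsymm : ∀ a b, B a b = B b a) :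
    CommGroup (PhaseExt A N) :=
  have hB' : ∀ a b c, B a (b + c) = B a b * B a c := fun a b c => by
    rw [hsymm, hB, hsymm b, hsymm c]
  have h0 : ∀ a, B 0 a = 1 := fun a => by simpa using hB 0 0 a
  { mul := fun x y => ⟨x.base + y.base, x.phase * y.phase * B x.base y.base⟩
    one := ⟨0, 1⟩
    inv := fun x => ⟨-x.base, x.phase⁻¹ * B x.base x.base⟩
    mul_assoc := fun x y z => by
      refine PhaseExt.ext (add_assoc _ _ _) ?_
      change x.phase * y.phase * B x.base y.base * z.phase * B (x.base + y.base) z.base =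
        x.phase * (y.phase * z.phase * B y.base z.base) * B x.base (y.base + z.base)
      rw [hB, hB']
      simp only [mul_left_comm, mul_comm]
    one_mul := fun x => by
      refine PhaseExt.ext (zero_add _) ?_
      change 1 * x.phase * B 0 x.base = x.phase
      rw [h0, one_mul, mul_one]
    mul_one := fun x => by
      refine PhaseExt.ext (add_zero _) ?_
      change x.phase * 1 * B x.base 0 = x.phase
      rw [hsymm, h0, mul_one, mul_one]
    inv_mul_cancel := fun x => by
      refine PhaseExt.ext (neg_add_cancel _) ?_
      change x.phase⁻¹ * B x.base x.base * x.phase * B (-x.base) x.base = 1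
      have h : B x.base x.base * B (-x.base) x.base = 1 := by
        rw [← hB, add_neg_cancel, h0]
      rw [mul_right_comm x.phase⁻¹, inv_mul_cancel, one_mul, h]
    mul_comm := fun x y => by
      refine PhaseExt.ext (add_comm _ _) ?_
      change x.phase * y.phase * B x.base y.base = y.phase * x.phase * B y.base x.base
      rw [hsymm, mul_comm x.phase] }

end PhaseExt

/-- A symmetric biadditive map into the `N`-th roots of unity is the coboundary of a map with
values in the `N`-th roots of unity, provided the associated extension has exponent `N`. -/
theorem exists_phase_of_symm_biadditive {A : Type*} [AddCommGroup A] [Finite A] {N : ℕ} [NeZero N]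
    (hA : ∀ a : A, N • a = 0) (B : A → A → rootsOfUnity N ℂ)
    (hB : ∀ a b c, B (a + b) c = B a c * B b c) (hsymm : ∀ a b, B a b = B b a)
    (hdiag : ∀ a, B a a ^ N.choose 2 = 1) :
    ∃ f : A → ℂ, (∀ a, f a ^ N = 1) ∧
      ∀ a b, f (a + b) = f a * f b * ((B a b : ℂˣ) : ℂ) := by
  let := PhaseExt.commGroup B hB hsymm
  have mul_def : ∀ x y : PhaseExt A N,
      x * y = ⟨x.base + y.base, x.phase * y.phase * B x.base y.base⟩ := fun _ _ => rfl
  have h0 : ∀ a, B 0 a = 1 := fun a => by simpa using hB 0 0 a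
  have hsmul : ∀ (m : ℕ) (a b : A), B (m • a) b = B a b ^ m := fun m a b => by
    induction m with
    | zero => simp [h0]
    | succ m ih => rw [succ_nsmul, hB, ih, pow_succ]
  have hpow : ∀ (x : PhaseExt A N) (m : ℕ),
      x ^ m = ⟨m • x.base, x.phase ^ m * B x.base x.base ^ m.choose 2⟩ := fun x m => by
    induction m with
    | zero => rw [pow_zero]; exact PhaseExt.ext (zero_nsmul _).symm (by simp; rfl)
    | succ m ih =>
      rw [pow_succ, ih, mul_def]
      refine PhaseExt.ext (succ_nsmul _ _).symm ?_
      dsimp only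
      rw [hsmul, Nat.choose_succ_succ' m 1, Nat.choose_one_right, pow_succ, pow_add]
      simp only [mul_assoc, mul_left_comm, mul_comm]
  have hroot : ∀ z : rootsOfUnity N ℂ, z ^ N = 1 := fun z => Subtype.ext z.2
  have hexp : ∀ x : PhaseExt A N, x ^ N = 1 := fun x => by
    rw [hpow, hA, hroot, hdiag, one_mul]; rfl
  have : Finite (PhaseExt A N) := Finite.of_injective
    (fun x : PhaseExt A N => (x.base, x.phase)) fun x y h =>
      PhaseExt.ext (congrArg Prod.fst h) (congrArg Prod.snd h)
  let ι : rootsOfUnity N ℂ →* PhaseExt A N :=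
    { toFun := fun z => ⟨0, z⟩
      map_one' := rfl
      map_mul' := fun z w => by
        rw [mul_def]; exact PhaseExt.ext (add_zero 0).symm (by simp [h0]) }
  have hι : Function.Injective ι := fun z w h => congrArg PhaseExt.phase h
  obtain ⟨φ, hφ⟩ := MonoidHom.domRestrict_surjective ℂ ι.range
    ((rootsOfUnity N ℂ).subtype.comp (MonoidHom.ofInjective hι).symm.toMonoidHom)
  have hφι : ∀ z, φ ⟨0, z⟩ = z := fun z => by
    have := DFunLike.congr_fun hφ (MonoidHom.ofInjective hι z)
    simp only [MulEquiv.toMonoidHom_eq_coe, MonoidHom.domRestrictHom_apply, MonoidHom.domRestrict_apply,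
      MonoidHom.comp_apply, MonoidHom.coe_coe, MulEquiv.symm_apply_apply] at this
    exact this
  have key : ∀ a b, φ ⟨a, 1⟩ * φ ⟨b, 1⟩ = φ ⟨a + b, 1⟩ * B a b := fun a b => by
    rw [← hφι, ← map_mul, ← map_mul, mul_def, mul_def]
    congr 2
    · simp
    · simp [hsymm _ 0, h0]
  refine ⟨fun a => ((φ ⟨a, 1⟩)⁻¹ : ℂˣ), fun a => ?_, fun a b => ?_⟩
  · rw [← Units.val_pow_eq_pow_val, inv_pow, ← map_pow, hexp, map_one, inv_one, Units.val_one]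
  · rw [← Units.val_mul, ← Units.val_mul, Units.val_inj, ← mul_inv, key, mul_inv, mul_assoc,
      inv_mul_cancel, mul_one]

namespace IsGenChar

variable {R : Type*} [CommRing R] [Fintype R] {χ : AddChar R ℂ}

theorem eq_zero_of_forall (hχ : IsGenChar χ) {s : R} (h : ∀ r, χ (s * r) = 1) : s = 0 := by
  by_contra hs
  obtain ⟨ψ, hψ⟩ := AddChar.exists_apply_ne_zero.2 hs
  obtain ⟨r, hr⟩ := hχ ψ
  exact hψ ((hr s).trans (h r))

theorem eq_of_forall_dotProduct (hχ : IsGenChar χ) {n : ℕ} {b b' : Fin n → R}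
    (h : ∀ x, χ (b ⬝ᵥ x) = χ (b' ⬝ᵥ x)) : b = b' := by
  classical
  funext i
  refine sub_eq_zero.1 (hχ.eq_zero_of_forall fun r => ?_)
  have := h (Pi.single i r)
  rw [dotProduct_single, dotProduct_single] at this
  rw [sub_mul, AddChar.map_sub_eq_div, this, div_self (χ.val_isUnit _).ne_zero]

end IsGenChar

section Pauli

variable {R : Type*} [CommRing R] [Fintype R] [DecidableEq R] {n : ℕ} {χ : AddChar R ℂ}

theorem XM_mul_ZM_apply (a b y x : Fin n → R) :
    (XM a * ZM χ b) y x = if y = x + a then χ (b ⬝ᵥ x) else 0 := by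
  simp [ZM, XM, Matrix.mul_diagonal]

theorem XM_zero_mul_ZM_zero : XM (0 : Fin n → R) * ZM χ 0 = 1 := by
  ext y x
  simp [XM_mul_ZM_apply, Matrix.one_apply]

theorem pauli_mul_pauli (a b a' b' : Fin n → R) :
    (XM a * ZM χ b) * (XM a' * ZM χ b') =
      χ (b ⬝ᵥ a') • (XM (a + a') * ZM χ (b + b')) := by
  ext y x
  rw [Matrix.mul_apply, Finset.sum_eq_single (x + a')]
  · simp only [XM_mul_ZM_apply, Matrix.smul_apply, smul_eq_mul, dotProduct_add, add_dotProduct,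
      AddChar.map_add_eq_mul, if_true, add_assoc, add_comm a']
    split_ifs <;> ring
  · intro z _ hz
    rw [XM_mul_ZM_apply a', if_neg hz, mul_zero]
  · simp

theorem eq_of_smul_pauli_eq (hχ : IsGenChar χ) {k l : ℂ} (hk : k ≠ 0)
    {a b a' b' : Fin n → R} (h : k • (XM a * ZM χ b) = l • (XM a' * ZM χ b')) :
    k = l ∧ a = a' ∧ b = b' := by
  have entry : ∀ y x, (k • (XM a * ZM χ b)) y x = (l • (XM a' * ZM χ b')) y x :=
    fun y x => by rw [h]
  simp only [Matrix.smul_apply, XM_mul_ZM_apply, smul_eq_mul] at entry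
  have ha : a = a' := by
    by_contra hne
    have := entry a 0
    simp [hne, hk] at this
  subst ha
  have hkl : k = l := by simpa using entry a 0
  subst hkl
  refine ⟨rfl, rfl, hχ.eq_of_forall_dotProduct fun x => ?_⟩
  simpa [hk] using entry (x + a) x

theorem symp_char_eq_one_of_commute {k l : ℂ} (hk : k ≠ 0) (hl : l ≠ 0)
    {v w : (Fin n → R) × (Fin n → R)} (hχ : IsGenChar χ)
    (h : (k • (XM v.1 * ZM χ v.2)) * (l • (XM w.1 * ZM χ w.2)) =
      (l • (XM w.1 * ZM χ w.2)) * (k • (XM v.1 * ZM χ v.2))) :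
    χ (sympForm v w) = 1 := by
  have hχ0 : ∀ r, χ r ≠ 0 := fun r => (χ.val_isUnit r).ne_zero
  simp only [smul_mul_smul_comm, pauli_mul_pauli, smul_smul] at h
  have := (eq_of_smul_pauli_eq hχ (by simp [hk, hl, hχ0]) h).1
  rw [mul_comm l k] at this
  have := mul_left_cancel₀ (mul_ne_zero hk hl) this
  rw [sympForm, AddChar.map_sub_eq_div, this, div_self (hχ0 _)]

end Pauli


/-- A submodule `C ⊆ R^{2n}` is a stabilizer code (`C = Ψ(S)` for some
stabilizer `S ≤ P_n`) iff it is self-orthogonal for the symplectic inner product. -/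
theorem stmt6 {R : Type*} [CommRing R] [Fintype R] [DecidableEq R] {n : ℕ}
    (χ : AddChar R ℂ) (hχ : IsGenChar χ) (ω : ℂ)
    (hω : IsPrimitiveRoot ω
      (if ringChar R % 2 = 1 then ringChar R else 2 * ringChar R))
    (C : Submodule R ((Fin n → R) × (Fin n → R))) :
    (∃ S : Set (Matrix (Fin n → R) (Fin n → R) ℂ),
        IsStabilizer χ ω S ∧ PsiIm χ ω S = (C : Set ((Fin n → R) × (Fin n → R)))) ↔
      (∀ v ∈ C, ∀ w ∈ C, sympForm v w = 0) := by
  set c := ringChar R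
  have hcpos : c ≠ 0 := CharP.ringChar_ne_zero_of_finite R
  set N := if c % 2 = 1 then c else 2 * c with hN
  have : NeZero N := ⟨by rw [hN]; split_ifs <;> omega⟩
  have hcN : c ∣ N := by rw [hN]; split_ifs <;> simp
  have hcN2 : c ∣ N.choose 2 := by
    rw [hN, Nat.choose_two_right]
    split_ifs with h
    · obtain ⟨k, hk⟩ : ∃ k, c = 2 * k + 1 := ⟨c / 2, by omega⟩
      rw [Nat.mul_div_assoc _ (by omega)]
      exact dvd_mul_right _ _
    · rw [mul_assoc, Nat.mul_div_cancel_left _ two_pos]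
      exact dvd_mul_right _ _
  have hcast : ∀ m : ℕ, c ∣ m → (m : R) = 0 := fun m hm => (ringChar.spec R m).2 hm
  have hχpow : ∀ m : ℕ, c ∣ m → ∀ r, χ r ^ m = 1 := fun m hm r => by
    rw [← AddChar.map_nsmul_eq_pow, nsmul_eq_mul, hcast m hm, zero_mul, AddChar.map_zero_eq_one]
  have hω0 : ω ≠ 0 := hω.ne_zero (NeZero.ne N)
  constructor
  · rintro ⟨S, ⟨-, -, -, hcomm, -, -⟩, hS⟩ v hv w hw
    have hmem : ∀ u ∈ C, ∃ ℓ : ℤ, ω ^ ℓ • (XM u.1 * ZM χ u.2) ∈ S := fun u hu => by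
      rw [← SetLike.mem_coe, ← hS] at hu
      exact hu
    obtain ⟨l, hl⟩ := hmem w hw
    refine hχ.eq_zero_of_forall fun r => ?_
    obtain ⟨k, hk⟩ := hmem _ (C.smul_mem r hv)
    have := symp_char_eq_one_of_commute (zpow_ne_zero k hω0) (zpow_ne_zero l hω0) hχ
      (hcomm _ hk _ hl)
    rwa [show sympForm (r • v) w = sympForm v w * r by
      simp only [sympForm, Prod.smul_fst, Prod.smul_snd, smul_dotProduct, dotProduct_smul,
        smul_eq_mul]
      ring] at this
  · intro hC
    let B : C → C → rootsOfUnity N ℂ := fun v w =>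
      rootsOfUnity.mkOfPowEq (χ (v.1.2 ⬝ᵥ w.1.1)) (hχpow N hcN _)
    have hBval : ∀ v w, ((B v w : ℂˣ) : ℂ) = χ (v.1.2 ⬝ᵥ w.1.1) := fun v w => rfl
    have hext : ∀ x y : rootsOfUnity N ℂ, ((x : ℂˣ) : ℂ) = ((y : ℂˣ) : ℂ) → x = y :=
      fun x y h => Subtype.ext (Units.ext h)
    obtain ⟨f, hfN, hf⟩ := exists_phase_of_symm_biadditive (A := C) (N := N)
      (fun a => by rw [← Nat.cast_smul_eq_nsmul R, hcast N hcN, zero_smul]) B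
      (fun a b d => hext _ _ (by
        simp [hBval, add_dotProduct, AddChar.map_add_eq_mul]))
      (fun a b => hext _ _ (by
        rw [hBval, hBval, sub_eq_zero.1 (hC a.1 a.2 b.1 b.2)]))
      (fun a => hext _ _ (by simpa [hBval] using hχpow _ hcN2 _))
    have hf0 : ∀ v, f v ≠ 0 := fun v h => by
      simpa [h, NeZero.ne N] using hfN v
    have hfω : ∀ v, ∃ ℓ : ℤ, ω ^ ℓ = f v := fun v => by
      obtain ⟨i, -, hi⟩ := hω.eq_pow_of_pow_eq_one (hfN v)
      exact ⟨i, by rw [zpow_natCast, hi]⟩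
    have hfzero : f 0 = 1 := by
      have := hf 0 0
      rw [hBval, add_zero] at this
      simpa [hf0] using this
    let P : C → Matrix (Fin n → R) (Fin n → R) ℂ := fun v => f v • (XM v.1.1 * ZM χ v.1.2)
    have hPmul : ∀ v w, P v * P w = P (v + w) := fun v w => by
      simp only [P, smul_mul_smul_comm, pauli_mul_pauli, smul_smul, hf, hBval]
      rfl
    have hPzero : P 0 = 1 := by
      simp only [P, hfzero, one_smul]
      exact XM_zero_mul_ZM_zero
    refine ⟨Set.range P, ⟨?_, ⟨0, hPzero⟩, ?_, ?_, ?_, ?_⟩, ?_⟩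
    · rintro _ ⟨v, rfl⟩
      obtain ⟨l, hl⟩ := hfω v
      exact ⟨l, v.1.1, v.1.2, by rw [hl]⟩
    · rintro _ ⟨v, rfl⟩ _ ⟨w, rfl⟩
      exact ⟨v + w, (hPmul v w).symm⟩
    · rintro _ ⟨v, rfl⟩ _ ⟨w, rfl⟩
      rw [hPmul, hPmul, add_comm]
    · rintro _ ⟨v, rfl⟩
      exact ⟨P (-v), ⟨-v, rfl⟩, by rw [hPmul, add_neg_cancel, hPzero]⟩
    · rintro _ ⟨v, rfl⟩ ⟨l, hl⟩
      rw [← XM_zero_mul_ZM_zero (χ := χ)] at hl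
      obtain ⟨-, h1, h2⟩ := eq_of_smul_pauli_eq hχ (hf0 v) hl
      rw [show v = 0 from Subtype.ext (Prod.ext h1 h2), hPzero]
    · ext p
      constructor
      · rintro ⟨l, v, hv⟩
        obtain ⟨-, h1, h2⟩ := eq_of_smul_pauli_eq hχ (hf0 v) hv
        exact (Prod.ext h1 h2 : v.1 = p) ▸ v.2
      · intro hp
        obtain ⟨l, hl⟩ := hfω ⟨p, hp⟩
        exact ⟨l, ⟨p, hp⟩, by rw [hl]⟩
end

section
/- Let R be a finite commutative Frobenius ring and f: R^{2n} → R^{2n} an R-linear map. Then f is a symplectic isometry (it preserves the symplectic weight wt_s and the symplectic inner product ⟨·,·⟩_s on all of R^{2n}) if and only if the matrix of γ ∘ f ∘ γ^{-1} with respect to the standard basis of (R^2)^n (acting on the right of row vectors) has the form diag(A_1,...,A_n)(P ⊗ I_2), where each A_i ∈ SL_2(R) and P is an n×n permutation matrix. -/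
open Matrix

/-- The symplectic weight on `R^{2n} = R^n × R^n`:
`wt_s(a,b) = #{i : (a_i,b_i) ≠ (0,0)}`. -/
def sympWt {R : Type*} [CommRing R] [DecidableEq R] {n : ℕ}
    (v : (Fin n → R) × (Fin n → R)) : ℕ :=
  (Finset.univ.filter fun i : Fin n => ¬(v.1 i = 0 ∧ v.2 i = 0)).card

/-- The coordinate change `γ : R^{2n} → (R²)^n`,
`(a₁,…,a_n,b₁,…,b_n) ↦ (a₁,b₁,…,a_n,b_n)`. -/
def gammaMap {R : Type*} [CommRing R] {n : ℕ}
    (v : (Fin n → R) × (Fin n → R)) : Fin n → Fin 2 → R :=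
  fun i => ![v.1 i, v.2 i]

lemma gammaMap_eq_zero_iff {R : Type*} [CommRing R] {n : ℕ}
    (v : (Fin n → R) × (Fin n → R)) (i : Fin n) :
    (v.1 i = 0 ∧ v.2 i = 0) ↔ gammaMap v i = 0 := by
  simp [gammaMap, funext_iff, Fin.forall_fin_two]

lemma vecMul_eq_zero_iff_of_det_eq_one {R : Type*} [CommRing R] {m : Type*} [Fintype m]
    [DecidableEq m] {A : Matrix m m R} (hA : A.det = 1) (x : m → R) :
    Matrix.vecMul x A = 0 ↔ x = 0 := by
  refine ⟨fun h => ?_, fun h => by simp [h]⟩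
  have h' := congrArg (fun y => Matrix.vecMul y A⁻¹) h
  simpa [Matrix.vecMul_vecMul, Matrix.mul_nonsing_inv A (by simp [hA])] using h'

lemma sympWt_eq_of_gammaMap_eq {R : Type*} [CommRing R] [DecidableEq R] {n : ℕ}
    {v w : (Fin n → R) × (Fin n → R)} {σ : Equiv.Perm (Fin n)}
    {A : Fin n → Matrix (Fin 2) (Fin 2) R} (hA : ∀ i, (A i).det = 1)
    (h : ∀ i, gammaMap w i = Matrix.vecMul (gammaMap v (σ i)) (A i)) :
    sympWt w = sympWt v := by
  refine Finset.card_equiv σ fun i => ?_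
  simp only [Finset.mem_filter, Finset.mem_univ, true_and]
  rw [gammaMap_eq_zero_iff, gammaMap_eq_zero_iff, h, vecMul_eq_zero_iff_of_det_eq_one (hA i)]

lemma sympForm_eq_sum {R : Type*} [CommRing R] {n : ℕ} (v w : (Fin n → R) × (Fin n → R)) :
    sympForm v w = ∑ i, (v.2 i * w.1 i - w.2 i * v.1 i) := by
  simp [sympForm, dotProduct]

lemma sympForm_eq_of_gammaMap_eq {R : Type*} [CommRing R] {n : ℕ}
    {v v' w w' : (Fin n → R) × (Fin n → R)} {σ : Equiv.Perm (Fin n)}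
    {A : Fin n → Matrix (Fin 2) (Fin 2) R} (hA : ∀ i, (A i).det = 1)
    (hv : ∀ i, gammaMap v' i = Matrix.vecMul (gammaMap v (σ i)) (A i))
    (hw : ∀ i, gammaMap w' i = Matrix.vecMul (gammaMap w (σ i)) (A i)) :
    sympForm v' w' = sympForm v w := by
  rw [sympForm_eq_sum, sympForm_eq_sum]
  refine Fintype.sum_equiv σ _ _ fun i => ?_
  have hd := hA i
  have hv0 := congrFun (hv i) 0
  have hv1 := congrFun (hv i) 1
  have hw0 := congrFun (hw i) 0
  have hw1 := congrFun (hw i) 1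
  simp only [gammaMap, Matrix.vecMul, dotProduct, Fin.sum_univ_two, Matrix.cons_val_zero,
    Matrix.cons_val_one] at hv0 hv1 hw0 hw1
  rw [Matrix.det_fin_two] at hd
  rw [hv0, hv1, hw0, hw1]
  linear_combination (v.2 (σ i) * w.1 (σ i) - w.2 (σ i) * v.1 (σ i)) * hd

lemma eq_sum_single_smul {R : Type*} [CommRing R] {n : ℕ} (v : (Fin n → R) × (Fin n → R)) :
    v = ∑ i, (v.1 i • ((Pi.single i 1, 0) : (Fin n → R) × (Fin n → R)) +
      v.2 i • ((0, Pi.single i 1) : (Fin n → R) × (Fin n → R))) := by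
  ext j <;> simp [Prod.fst_sum, Prod.snd_sum, Finset.sum_apply, Pi.single_apply]

lemma sympWt_le_one {R : Type*} [CommRing R] [DecidableEq R] {n : ℕ}
    {v : (Fin n → R) × (Fin n → R)} {j : Fin n} (h : ∀ k, k ≠ j → v.1 k = 0 ∧ v.2 k = 0) :
    sympWt v ≤ 1 := by
  refine (Finset.card_le_card (t := {j}) fun k hk => ?_).trans (by simp)
  by_contra hkj
  exact (Finset.mem_filter.1 hk).2 (h k (by simpa using hkj))

lemma two_le_sympWt {R : Type*} [CommRing R] [DecidableEq R] {n : ℕ}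
    {v : (Fin n → R) × (Fin n → R)} {j k : Fin n} (hjk : j ≠ k)
    (hj : ¬(v.1 j = 0 ∧ v.2 j = 0)) (hk : ¬(v.1 k = 0 ∧ v.2 k = 0)) :
    2 ≤ sympWt v := by
  rw [← Finset.card_pair hjk]
  refine Finset.card_le_card fun i hi => ?_
  rcases Finset.mem_insert.1 hi with rfl | hi
  · simpa using hj
  · rw [Finset.mem_singleton.1 hi]
    simpa using hk

lemma exists_support_of_sympWt_eq_one {R : Type*} [CommRing R] [DecidableEq R] {n : ℕ}
    {v : (Fin n → R) × (Fin n → R)} (h : sympWt v = 1) :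
    ∃ j, ¬(v.1 j = 0 ∧ v.2 j = 0) ∧ ∀ k, k ≠ j → v.1 k = 0 ∧ v.2 k = 0 := by
  obtain ⟨j, hj⟩ := Finset.card_eq_one.1 h
  have key : ∀ k, ¬(v.1 k = 0 ∧ v.2 k = 0) ↔ k = j := fun k => by
    simpa using Finset.ext_iff.1 hj k
  exact ⟨j, (key j).2 rfl, fun k hk => not_not.1 (mt (key k).1 hk)⟩

lemma exists_common_support {R : Type*} [CommRing R] [DecidableEq R] {n : ℕ}
    {v w : (Fin n → R) × (Fin n → R)} (hv : sympWt v = 1) (hw : sympWt w = 1)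
    (hvw : sympWt (v + w) = 1) :
    ∃ j, ∀ k, k ≠ j → (v.1 k = 0 ∧ v.2 k = 0) ∧ (w.1 k = 0 ∧ w.2 k = 0) := by
  obtain ⟨j, hj, hj'⟩ := exists_support_of_sympWt_eq_one hv
  obtain ⟨l, hl, hl'⟩ := exists_support_of_sympWt_eq_one hw
  obtain rfl : j = l := by
    by_contra hjl
    have := two_le_sympWt (v := v + w) hjl (by simpa [hl' j hjl] using hj)
      (by simpa [hj' l (Ne.symm hjl)] using hl)
    omega
  exact ⟨j, fun k hk => ⟨hj' k hk, hl' k hk⟩⟩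

/-- A weight preserving linear map sends each coordinate block into a single block, and distinct
blocks into distinct blocks. -/
lemma exists_perm_of_sympWt_eq {R : Type*} [CommRing R] [DecidableEq R] [Nontrivial R] {n : ℕ}
    (f : ((Fin n → R) × (Fin n → R)) →ₗ[R] ((Fin n → R) × (Fin n → R)))
    (hf : ∀ v, sympWt (f v) = sympWt v) :
    ∃ τ : Equiv.Perm (Fin n), ∀ i k, k ≠ τ i →
      ((f (Pi.single i 1, 0)).1 k = 0 ∧ (f (Pi.single i 1, 0)).2 k = 0) ∧
      ((f (0, Pi.single i 1)).1 k = 0 ∧ (f (0, Pi.single i 1)).2 k = 0) := by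
  have h (i : Fin n) : ∃ j, ∀ k, k ≠ j →
      ((f (Pi.single i 1, 0)).1 k = 0 ∧ (f (Pi.single i 1, 0)).2 k = 0) ∧
      ((f (0, Pi.single i 1)).1 k = 0 ∧ (f (0, Pi.single i 1)).2 k = 0) := by
    apply exists_common_support
    · rw [hf]; simp [sympWt, Pi.single_apply, Finset.filter_eq']
    · rw [hf]; simp [sympWt, Pi.single_apply, Finset.filter_eq']
    · rw [← map_add, hf]; simp [sympWt, Pi.single_apply, Finset.filter_eq']
  choose τ hτ using h
  have hinj : Function.Injective τ := by
    intro i k hik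
    by_contra hne
    have hle : sympWt (f ((Pi.single i 1, 0) + (Pi.single k 1, 0))) ≤ 1 := by
      refine sympWt_le_one (j := τ i) fun l hl => ?_
      rw [map_add]
      simp [hτ i l hl, hτ k l (hik ▸ hl)]
    rw [hf] at hle
    have := two_le_sympWt
      (v := ((Pi.single i 1, 0) + (Pi.single k 1, 0) : (Fin n → R) × (Fin n → R))) hne
      (by simp [hne]) (by simp [Ne.symm hne])
    omega
  exact ⟨Equiv.ofBijective τ (Finite.injective_iff_bijective.1 hinj), hτ⟩

/-- A linear map `f : R^{2n} → R^{2n}` is a symplectic isometry iff,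
in the `γ`-coordinates, it is an `SL₂(R)`-monomial map: block `i` of `γ(f v)` is block
`σ(i)` of `γ(v)` multiplied (as a row vector) by some `A_i ∈ SL₂(R)`. -/
theorem stmt7 {R : Type*} [CommRing R] [Fintype R] [DecidableEq R] {n : ℕ}
    (hFrob : ∃ χ : AddChar R ℂ, IsGenChar χ)
    (f : ((Fin n → R) × (Fin n → R)) →ₗ[R] ((Fin n → R) × (Fin n → R))) :
    ((∀ v, sympWt (f v) = sympWt v) ∧
      (∀ v w, sympForm (f v) (f w) = sympForm v w)) ↔
    (∃ (σ : Equiv.Perm (Fin n)) (A : Fin n → Matrix (Fin 2) (Fin 2) R),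
      (∀ i, (A i).det = 1) ∧
      ∀ v (i : Fin n), gammaMap (f v) i = Matrix.vecMul (gammaMap v (σ i)) (A i)) := by
  constructor
  · rintro ⟨hwt, hform⟩
    cases subsingleton_or_nontrivial R
    · exact ⟨1, fun _ => 1, fun _ => Subsingleton.elim _ _, fun _ _ => Subsingleton.elim _ _⟩
    obtain ⟨τ, hτ⟩ := exists_perm_of_sympWt_eq f hwt
    refine ⟨τ.symm, fun j => Matrix.of ![gammaMap (f (Pi.single (τ.symm j) 1, 0)) j,
      gammaMap (f (0, Pi.single (τ.symm j) 1)) j], fun j => ?_, fun v j => ?_⟩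
    · obtain ⟨i, rfl⟩ := τ.surjective j
      have h := hform (Pi.single i 1, 0) (0, Pi.single i 1)
      rw [sympForm_eq_sum, Finset.sum_eq_single (τ i)
        (fun k _ hk => by simp [hτ i k hk]) (by simp)] at h
      simp only [sympForm, zero_dotProduct, single_dotProduct, Pi.single_eq_same] at h
      simp only [Matrix.det_fin_two, gammaMap, Equiv.symm_apply_apply, Matrix.of_apply,
        Matrix.cons_val_zero, Matrix.cons_val_one]
      linear_combination -h
    · have hv : ∀ k ∈ Finset.univ, k ≠ τ.symm j → j ≠ τ k := by
        rintro k - hk rfl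
        simp at hk
      have h := congrArg f (eq_sum_single_smul v)
      simp only [map_sum, map_add, map_smul] at h
      have h1 := congrFun (congrArg Prod.fst h) j
      have h2 := congrFun (congrArg Prod.snd h) j
      rw [Prod.fst_sum, Finset.sum_apply, Finset.sum_eq_single (τ.symm j)
        (fun k hk hkj => by simp [hτ k j (hv k hk hkj)]) (by simp)] at h1
      rw [Prod.snd_sum, Finset.sum_apply, Finset.sum_eq_single (τ.symm j)
        (fun k hk hkj => by simp [hτ k j (hv k hk hkj)]) (by simp)] at h2
      ext c
      fin_cases c
      · simpa [gammaMap, Matrix.vecMul, dotProduct, Fin.sum_univ_two] using h1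
      · simpa [gammaMap, Matrix.vecMul, dotProduct, Fin.sum_univ_two] using h2
  · rintro ⟨σ, A, hA, h⟩
    exact ⟨fun v => sympWt_eq_of_gammaMap_eq hA (h v),
      fun v w => sympForm_eq_of_gammaMap_eq hA (h v) (h w)⟩
end

section
/- There exist a stabilizer code C ⊆ F_2^{2·4} (a self-orthogonal F_2-subspace of F_2^8 with respect to the symplectic inner product) and an F_2-linear map f: C → F_2^8 that preserves the symplectic weight and the symplectic inner product on C (i.e., f is a symplectic isometry) but is not the restriction to C of any SL_2(F_2)-monomial map of F_2^8. Consequently, for this code the containment Mon_SL(C) ⊆ Symp(C) of isometry groups is strict. -/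
open Matrix

/-- The word with symbols `(x, y), (x, y), (z, 0), (x + z, 0)`. -/
def codeword (x y z : ZMod 2) : (Fin 4 → ZMod 2) × (Fin 4 → ZMod 2) :=
  (![x, x, z, x + z], ![y, y, 0, 0])

/-- The code of all words `codeword x y z`. -/
def swapCode : Submodule (ZMod 2) ((Fin 4 → ZMod 2) × (Fin 4 → ZMod 2)) where
  carrier := {v | ∃ x y z, codeword x y z = v}
  zero_mem' := ⟨0, 0, 0, by decide⟩
  add_mem' := by
    rintro _ _ ⟨x, y, z, rfl⟩ ⟨x', y', z', rfl⟩
    refine ⟨x + x', y + y', z + z', ?_⟩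
    ext i <;> fin_cases i <;> simp [codeword] <;> ring
  smul_mem' := by
    rintro c _ ⟨x, y, z, rfl⟩
    refine ⟨c * x, c * y, c * z, ?_⟩
    ext i <;> fin_cases i <;> simp [codeword] <;> ring

/-- A linear map of the ambient space sending `codeword x y z` to `codeword x z y`. -/
def swapMap : (Fin 4 → ZMod 2) × (Fin 4 → ZMod 2) →ₗ[ZMod 2]
    (Fin 4 → ZMod 2) × (Fin 4 → ZMod 2) where
  toFun v := codeword (v.1 0) (v.1 2) (v.2 0)
  map_add' v w := by
    ext i <;> fin_cases i <;> simp [codeword] <;> ring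
  map_smul' c v := by
    ext i <;> fin_cases i <;> simp [codeword] <;> ring

theorem swapMap_codeword (x y z : ZMod 2) :
    swapMap (codeword x y z) = codeword x z y := rfl

theorem codeword_mem_swapCode (x y z : ZMod 2) : codeword x y z ∈ swapCode :=
  ⟨x, y, z, rfl⟩

theorem codeword_eq_iff {x y z x' y' z' : ZMod 2} :
    codeword x y z = codeword x' y' z' ↔ x = x' ∧ y = y' ∧ z = z' := by
  refine ⟨fun h => ⟨congrArg (fun v => v.1 0) h, congrArg (fun v => v.2 0) h,
    congrArg (fun v => v.1 2) h⟩, ?_⟩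
  rintro ⟨rfl, rfl, rfl⟩
  rfl

theorem sympForm_codeword (x y z x' y' z' : ZMod 2) :
    sympForm (codeword x y z) (codeword x' y' z') = 0 := by
  revert x y z x' y' z'
  decide

theorem sympWt_codeword_swap (x y z : ZMod 2) :
    sympWt (codeword x z y) = sympWt (codeword x y z) := by
  revert x y z
  decide

/-- Every symbol position of the code vanishes on a word whose image under the swap is nonzero in
position `0`. -/
theorem exists_codeword_vanishing (j : Fin 4) :
    ∃ x y z, gammaMap (codeword x y z) j = 0 ∧ gammaMap (codeword x z y) 0 ≠ 0 := by
  revert j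
  decide

/-- There is a stabilizer code `C ⊆ F₂^{2·4}` (a self-orthogonal
subspace for the symplectic form) and a symplectic isometry `f` of `C` (a linear
automorphism of `C` preserving symplectic weight and symplectic inner product)
which is not the restriction to `C` of any `SL₂(F₂)`-monomial map of `F₂^8`.
Hence `Mon_SL(C) ⊊ Symp(C)`. -/
theorem stmt8 :
    ∃ C : Submodule (ZMod 2) ((Fin 4 → ZMod 2) × (Fin 4 → ZMod 2)),
      (∀ v ∈ C, ∀ w ∈ C, sympForm v w = 0) ∧
      ∃ f : C →ₗ[ZMod 2] ((Fin 4 → ZMod 2) × (Fin 4 → ZMod 2)),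
        (∀ v : C, f v ∈ C) ∧
        Function.Injective f ∧
        (∀ v : C, sympWt (f v) = sympWt (v : (Fin 4 → ZMod 2) × (Fin 4 → ZMod 2))) ∧
        (∀ v w : C, sympForm (f v) (f w) =
          sympForm (v : (Fin 4 → ZMod 2) × (Fin 4 → ZMod 2)) w) ∧
        ¬ ∃ (σ : Equiv.Perm (Fin 4)) (A : Fin 4 → Matrix (Fin 2) (Fin 2) (ZMod 2)),
            (∀ i, (A i).det = 1) ∧
            ∀ (v : C) (i : Fin 4),
              gammaMap (f v) i =
                Matrix.vecMul (gammaMap (v : (Fin 4 → ZMod 2) × (Fin 4 → ZMod 2)) (σ i)) (A i) := by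
  refine ⟨swapCode, ?_, swapMap.domRestrict swapCode, ?_, ?_, ?_, ?_, ?_⟩
  · rintro _ ⟨x, y, z, rfl⟩ _ ⟨x', y', z', rfl⟩
    exact sympForm_codeword x y z x' y' z'
  · exact fun _ => codeword_mem_swapCode _ _ _
  · rintro ⟨_, x, y, z, rfl⟩ ⟨_, x', y', z', rfl⟩ h
    obtain ⟨hx, hz, hy⟩ := codeword_eq_iff.mp h
    exact Subtype.ext (codeword_eq_iff.mpr ⟨hx, hy, hz⟩)
  · rintro ⟨_, x, y, z, rfl⟩
    exact sympWt_codeword_swap x y z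
  · rintro ⟨_, x, y, z, rfl⟩ ⟨_, x', y', z', rfl⟩
    exact (sympForm_codeword x z y x' z' y').trans (sympForm_codeword x y z x' y' z').symm
  · rintro ⟨σ, A, -, hA⟩
    obtain ⟨x, y, z, h0, hne⟩ := exists_codeword_vanishing (σ 0)
    have h := hA ⟨codeword x y z, codeword_mem_swapCode x y z⟩ 0
    rw [LinearMap.domRestrict_apply, swapMap_codeword, h0, Matrix.zero_vecMul] at h
    exact hne h
end

section
/- Let C ⊆ (F_q^2)^n be an F_q-linear self-orthogonal code of dimension k with generator matrix H. Then the subgroup rMon(C) ≤ GL_k(F_q) is closed with respect to the left action of GL_k(F_q) on the orbit space O^#, and the subgroup Iso(C) ≤ GL_k(F_q) is closed with respect to the right action of GL_k(F_q) on the orbit space O. -/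
open Matrix

/-- Hamming weight on `(F²)^ι`, blocks indexed by `ι`:
`wt_H(v) = #{i : (v_{i,0}, v_{i,1}) ≠ (0,0)}`. -/
def wtH {F : Type*} [CommRing F] [DecidableEq F] {ι : Type*} [Fintype ι]
    (v : ι × Fin 2 → F) : ℕ :=
  (Finset.univ.filter fun i : ι =>
    ¬(v (i, (0 : Fin 2)) = 0 ∧ v (i, (1 : Fin 2)) = 0)).card

/-- The symplectic form `⟨x,y⟩ = Σ_i x_i J y_iᵀ` on `(F²)^ι`, `J = [[0,-1],[1,0]]`. -/
def sympFormI {F : Type*} [CommRing F] {ι : Type*} [Fintype ι]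
    (v w : ι × Fin 2 → F) : F :=
  ∑ i : ι, (v (i, (1 : Fin 2)) * w (i, (0 : Fin 2)) -
            v (i, (0 : Fin 2)) * w (i, (1 : Fin 2)))

/-- A monomial map of `(F²)^ι` given by a permutation `σ` of the blocks and a family
of `2×2` matrices `A_i`: block `i` of the output is block `σ(i)` of the input times `A_i`. -/
def monoApply {F : Type*} [CommRing F] {ι : Type*}
    (σ : Equiv.Perm ι) (A : ι → Matrix (Fin 2) (Fin 2) F)
    (v : ι × Fin 2 → F) : ι × Fin 2 → F :=
  fun p => Matrix.vecMul (fun s => v (σ p.1, s)) (A p.1) p.2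

/-- The isometry group `Iso(C) = {B ∈ GL_k(F) : wt_H(xBH) = wt_H(xH) ∀x}` of the code
with generator matrix `H`, as a subset of `GL_k(F)`. -/
def IsoSet {F : Type*} [CommRing F] [DecidableEq F] {k : ℕ} {ι : Type*} [Fintype ι]
    (H : Matrix (Fin k) (ι × Fin 2) F) : Set (Matrix.GeneralLinearGroup (Fin k) F) :=
  {B | ∀ x : Fin k → F,
    wtH (Matrix.vecMul (Matrix.vecMul x (B : Matrix (Fin k) (Fin k) F)) H) =
      wtH (Matrix.vecMul x H)}

/-- `rMon(C)`: those `B ∈ GL_k(F)` such that `xH ↦ xBH` is the restriction to `C` of a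
(`GL₂(F)`-) monomial map of the ambient space. -/
def rMonSet {F : Type*} [CommRing F] {k : ℕ} {ι : Type*} [Fintype ι]
    (H : Matrix (Fin k) (ι × Fin 2) F) : Set (Matrix.GeneralLinearGroup (Fin k) F) :=
  {B | ∃ (σ : Equiv.Perm ι) (A : ι → Matrix (Fin 2) (Fin 2) F),
    (∀ i, IsUnit (A i).det) ∧
    ∀ x : Fin k → F,
      Matrix.vecMul (Matrix.vecMul x (B : Matrix (Fin k) (Fin k) F)) H =
        monoApply σ A (Matrix.vecMul x H)}

/-- `rMon_SL(C)`: those `B ∈ GL_k(F)` such that `xH ↦ xBH` is the restriction to `C`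
of an `SL₂(F)`-monomial map of the ambient space. -/
def rMonSLSet {F : Type*} [CommRing F] {k : ℕ} {ι : Type*} [Fintype ι]
    (H : Matrix (Fin k) (ι × Fin 2) F) : Set (Matrix.GeneralLinearGroup (Fin k) F) :=
  {B | ∃ (σ : Equiv.Perm ι) (A : ι → Matrix (Fin 2) (Fin 2) F),
    (∀ i, (A i).det = 1) ∧
    ∀ x : Fin k → F,
      Matrix.vecMul (Matrix.vecMul x (B : Matrix (Fin k) (Fin k) F)) H =
        monoApply σ A (Matrix.vecMul x H)}

/-- `Hs ⊆ GL_k(F)` is closed with respect to the left action of `GL_k(F)` on the orbit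
space `O^#` of the right `GL₂(F)`-multiplication action on `k×2` matrices: `Hs` equals
its closure `{g : g · orb_{Hs}(x) = orb_{Hs}(x) for all x ∈ O^#}` (orbit sets in the
quotient being identified with their saturated preimages in the matrix space). -/
def ClosedOsharp {F : Type*} [CommRing F] {k : ℕ}
    (Hs : Set (Matrix.GeneralLinearGroup (Fin k) F)) : Prop :=
  ∀ g : Matrix.GeneralLinearGroup (Fin k) F,
    (∀ M : Matrix (Fin k) (Fin 2) F,
      {N : Matrix (Fin k) (Fin 2) F | ∃ B ∈ Hs, ∃ A : Matrix.GeneralLinearGroup (Fin 2) F,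
        N = (g : Matrix (Fin k) (Fin k) F) * (B : Matrix (Fin k) (Fin k) F) * M *
            (A : Matrix (Fin 2) (Fin 2) F)} =
      {N : Matrix (Fin k) (Fin 2) F | ∃ B ∈ Hs, ∃ A : Matrix.GeneralLinearGroup (Fin 2) F,
        N = (B : Matrix (Fin k) (Fin k) F) * M * (A : Matrix (Fin 2) (Fin 2) F)})
    ↔ g ∈ Hs

/-- `Hs ⊆ GL_k(F)` is closed with respect to the right action of `GL_k(F)` on the orbit
space `O` of the scalar `Fˣ`-action on `F^k`:  `Hs` equals its closure
`{g : orb_{Hs}(x) · g = orb_{Hs}(x) for all x ∈ O}`. -/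
def ClosedO {F : Type*} [CommRing F] {k : ℕ}
    (Hs : Set (Matrix.GeneralLinearGroup (Fin k) F)) : Prop :=
  ∀ g : Matrix.GeneralLinearGroup (Fin k) F,
    (∀ x : Fin k → F,
      {y : Fin k → F | ∃ B ∈ Hs, ∃ u : Fˣ,
        y = (u : F) • Matrix.vecMul x
          ((B : Matrix (Fin k) (Fin k) F) * (g : Matrix (Fin k) (Fin k) F))} =
      {y : Fin k → F | ∃ B ∈ Hs, ∃ u : Fˣ,
        y = (u : F) • Matrix.vecMul x (B : Matrix (Fin k) (Fin k) F)})
    ↔ g ∈ Hs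

/-- Right equivalence of `k × 2` matrices under multiplication by `GL₂(F)`. -/
def blockSetoid (F : Type*) [CommRing F] (k : ℕ) : Setoid (Matrix (Fin k) (Fin 2) F) where
  r M N := ∃ A : Matrix.GeneralLinearGroup (Fin 2) F, N = M * (A : Matrix (Fin 2) (Fin 2) F)
  iseqv :=
    { refl := fun M => ⟨1, by simp⟩
      symm := by
        rintro M _ ⟨A, rfl⟩
        exact ⟨A⁻¹, by rw [Matrix.mul_assoc, ← Units.val_mul]; simp⟩
      trans := by
        rintro M _ _ ⟨A, rfl⟩ ⟨A', rfl⟩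
        exact ⟨A * A', by rw [Units.val_mul, Matrix.mul_assoc]⟩ }

/-- The orbit space of `k × 2` matrices under right multiplication by `GL₂(F)`. -/
abbrev BlockOrbit (F : Type*) [CommRing F] (k : ℕ) : Type _ := Quotient (blockSetoid F k)

/-- The orbit of a `k × 2` matrix under right multiplication by `GL₂(F)`. -/
def blockOrbit {F : Type*} [CommRing F] {k : ℕ} (M : Matrix (Fin k) (Fin 2) F) : BlockOrbit F k :=
  Quotient.mk _ M

theorem blockOrbit_eq_iff {F : Type*} [CommRing F] {k : ℕ} {M N : Matrix (Fin k) (Fin 2) F} :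
    blockOrbit M = blockOrbit N ↔
      ∃ A : Matrix.GeneralLinearGroup (Fin 2) F, N = M * (A : Matrix (Fin 2) (Fin 2) F) :=
  Quotient.eq

instance {F : Type*} [CommRing F] {k : ℕ} :
    MulAction (Matrix.GeneralLinearGroup (Fin k) F) (BlockOrbit F k) where
  smul B := Quotient.map (fun M => (B : Matrix (Fin k) (Fin k) F) * M) (by
    rintro M _ ⟨A, rfl⟩
    exact ⟨A, by rw [Matrix.mul_assoc]⟩)
  one_smul := by
    rintro ⟨M⟩
    exact congrArg blockOrbit (Matrix.one_mul M)
  mul_smul := by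
    rintro B B' ⟨M⟩
    exact congrArg blockOrbit (Matrix.mul_assoc _ _ M)

theorem smul_blockOrbit {F : Type*} [CommRing F] {k : ℕ}
    (B : Matrix.GeneralLinearGroup (Fin k) F) (M : Matrix (Fin k) (Fin 2) F) :
    B • blockOrbit M = blockOrbit ((B : Matrix (Fin k) (Fin k) F) * M) :=
  rfl

/-- A subgroup is closed for the action on `BlockOrbit` as soon as it contains every matrix
moving each orbit within its orbit under the subgroup. -/
theorem closedOsharp_of_subgroup {F : Type*} [CommRing F] {k : ℕ}
    (K : Subgroup (Matrix.GeneralLinearGroup (Fin k) F))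
    (hK : ∀ g : Matrix.GeneralLinearGroup (Fin k) F,
      (∀ q : BlockOrbit F k, ∃ B ∈ K, g • q = B • q) → g ∈ K) :
    ClosedOsharp (K : Set (Matrix.GeneralLinearGroup (Fin k) F)) := by
  intro g
  constructor
  · intro h
    refine hK g ?_
    rintro ⟨M⟩
    obtain ⟨B, hB, A, hA⟩ := (h M).subset ⟨1, K.one_mem, 1, rfl⟩
    refine ⟨B, hB, ?_⟩
    change g • blockOrbit M = B • blockOrbit M
    rw [smul_blockOrbit, smul_blockOrbit, eq_comm, blockOrbit_eq_iff]
    exact ⟨A, by simpa using hA⟩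
  · intro hg M
    ext N
    constructor
    · rintro ⟨B, hB, A, rfl⟩
      exact ⟨g * B, K.mul_mem hg hB, A, by rw [Units.val_mul]⟩
    · rintro ⟨B, hB, A, rfl⟩
      exact ⟨g⁻¹ * B, K.mul_mem (K.inv_mem hg) hB, A, by
        rw [← Units.val_mul, mul_inv_cancel_left]⟩

/-- A subgroup is closed for the action on lines as soon as it contains every matrix
moving each line within its orbit under the subgroup. -/
theorem closedO_of_subgroup {F : Type*} [CommRing F] {k : ℕ}
    (K : Subgroup (Matrix.GeneralLinearGroup (Fin k) F))
    (hK : ∀ g : Matrix.GeneralLinearGroup (Fin k) F,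
      (∀ x : Fin k → F, ∃ B ∈ K, ∃ u : Fˣ,
        Matrix.vecMul x (g : Matrix (Fin k) (Fin k) F) =
          (u : F) • Matrix.vecMul x (B : Matrix (Fin k) (Fin k) F)) → g ∈ K) :
    ClosedO (K : Set (Matrix.GeneralLinearGroup (Fin k) F)) := by
  intro g
  constructor
  · intro h
    refine hK g fun x => (h x).subset ⟨1, K.one_mem, 1, by simp⟩
  · intro hg x
    ext y
    constructor
    · rintro ⟨B, hB, u, rfl⟩
      exact ⟨B * g, K.mul_mem hB hg, u, by rw [Units.val_mul]⟩
    · rintro ⟨B, hB, u, rfl⟩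
      exact ⟨B * g⁻¹, K.mul_mem hB (K.inv_mem hg), u, by
        rw [← Units.val_mul, inv_mul_cancel_right]⟩

/-- The isometry group as a subgroup of `GL_k(F)`. -/
def isoSubgroup {F : Type*} [CommRing F] [DecidableEq F] {k : ℕ} {ι : Type*} [Fintype ι]
    (H : Matrix (Fin k) (ι × Fin 2) F) : Subgroup (Matrix.GeneralLinearGroup (Fin k) F) where
  carrier := IsoSet H
  one_mem' x := by simp
  mul_mem' {B B'} hB hB' x := by
    rw [Units.val_mul, ← Matrix.vecMul_vecMul, hB', hB]
  inv_mem' {B} hB x := by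
    rw [← hB (Matrix.vecMul x _), Matrix.vecMul_vecMul x, ← Units.val_mul]
    simp

theorem wtH_units_smul {F : Type*} [CommRing F] [DecidableEq F] {ι : Type*} [Fintype ι]
    (u : Fˣ) (v : ι × Fin 2 → F) : wtH ((u : F) • v) = wtH v := by
  simp [wtH]

/-- The `k × 2` block of `H` at position `i`. -/
def block {F : Type*} {k : ℕ} {ι : Type*} (H : Matrix (Fin k) (ι × Fin 2) F) (i : ι) :
    Matrix (Fin k) (Fin 2) F :=
  H.submatrix id (Prod.mk i)

/-- The multiset of orbits of the blocks of `H`. -/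
def blockOrbits {F : Type*} [CommRing F] {k : ℕ} {ι : Type*} [Fintype ι]
    (H : Matrix (Fin k) (ι × Fin 2) F) : Multiset (BlockOrbit F k) :=
  Finset.univ.val.map fun i => blockOrbit (block H i)

theorem mem_rMonSet_iff_block {F : Type*} [CommRing F] {k : ℕ} {ι : Type*} [Fintype ι]
    {H : Matrix (Fin k) (ι × Fin 2) F} {B : Matrix.GeneralLinearGroup (Fin k) F} :
    B ∈ rMonSet H ↔ ∃ (σ : Equiv.Perm ι) (A : ι → Matrix (Fin 2) (Fin 2) F),
      (∀ i, IsUnit (A i).det) ∧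
        ∀ i, (B : Matrix (Fin k) (Fin k) F) * block H i = block H (σ i) * A i := by
  refine exists_congr fun σ => exists_congr fun A => and_congr_right fun _ => ?_
  have hl : ∀ (x : Fin k → F) (i : ι) (s : Fin 2),
      Matrix.vecMul (Matrix.vecMul x (B : Matrix (Fin k) (Fin k) F)) H (i, s) =
        Matrix.vecMul x ((B : Matrix (Fin k) (Fin k) F) * block H i) s := by
    intro x i s
    rw [← Matrix.vecMul_vecMul]
    rfl
  have hr : ∀ (x : Fin k → F) (i : ι) (s : Fin 2),
      monoApply σ A (Matrix.vecMul x H) (i, s) =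
        Matrix.vecMul x (block H (σ i) * A i) s := by
    intro x i s
    rw [← Matrix.vecMul_vecMul]
    rfl
  constructor
  · intro h i
    refine Matrix.ext_of_single_vecMul fun j => ?_
    ext s
    rw [← hl, ← hr, h]
  · intro h x
    ext ⟨i, s⟩
    rw [hl, hr, h]

/-- Two families on a finite type have the same multiset of values exactly when they differ by
a permutation of the index type. -/
theorem multiset_map_univ_eq_iff {ι β : Type*} [Fintype ι] (f g : ι → β) :
    Finset.univ.val.map f = Finset.univ.val.map g ↔ ∃ σ : Equiv.Perm ι, f = g ∘ σ := by
  classical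
  constructor
  · intro h
    have hcard : ∀ b, Fintype.card {i // f i = b} = Fintype.card {i // g i = b} := by
      intro b
      have hb := congrArg (Multiset.count b) h
      simp only [Multiset.count_map, eq_comm (a := b)] at hb
      rw [Fintype.card_subtype, Fintype.card_subtype]
      exact hb
    exact ⟨Equiv.ofFiberEquiv fun b => Fintype.equivOfCardEq (hcard b),
      funext fun i => (Equiv.ofFiberEquiv_map _ i).symm⟩
  · rintro ⟨σ, rfl⟩
    rw [← Multiset.map_map, Multiset.map_univ_val_equiv]

theorem mem_rMonSet_iff {F : Type*} [CommRing F] {k : ℕ} {ι : Type*} [Fintype ι]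
    {H : Matrix (Fin k) (ι × Fin 2) F} {B : Matrix.GeneralLinearGroup (Fin k) F} :
    B ∈ rMonSet H ↔ (blockOrbits H).map (B • ·) = blockOrbits H := by
  rw [mem_rMonSet_iff_block, blockOrbits, Multiset.map_map, multiset_map_univ_eq_iff]
  refine exists_congr fun σ => ?_
  constructor
  · rintro ⟨A, hA, h⟩
    ext i
    refine Eq.symm (blockOrbit_eq_iff.2 ⟨Matrix.GeneralLinearGroup.mk'' (A i) (hA i), ?_⟩)
    exact h i
  · intro h
    have h' : ∀ i, ∃ A : Matrix.GeneralLinearGroup (Fin 2) F,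
        (B : Matrix (Fin k) (Fin k) F) * block H i =
          block H (σ i) * (A : Matrix (Fin 2) (Fin 2) F) :=
      fun i => blockOrbit_eq_iff.1 (congrFun h i).symm
    choose A hA using h'
    exact ⟨fun i => A i, fun i => Matrix.isUnits_det_units (A i), hA⟩

/-- `rMon(C)` as a subgroup of `GL_k(F)`. -/
def rMonSubgroup {F : Type*} [CommRing F] {k : ℕ} {ι : Type*} [Fintype ι]
    (H : Matrix (Fin k) (ι × Fin 2) F) : Subgroup (Matrix.GeneralLinearGroup (Fin k) F) where
  carrier := rMonSet H
  one_mem' := by simp [mem_rMonSet_iff]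
  mul_mem' {B B'} hB hB' := by
    rw [mem_rMonSet_iff] at *
    conv_rhs => rw [← hB, ← hB']
    simp [Multiset.map_map, mul_smul]
  inv_mem' {B} hB := by
    rw [mem_rMonSet_iff] at *
    conv_lhs => rw [← hB]
    simp [Multiset.map_map]

theorem mem_rMonSet_of_forall_smul_eq {F : Type*} [CommRing F] {k : ℕ} {ι : Type*} [Fintype ι]
    {H : Matrix (Fin k) (ι × Fin 2) F} {g : Matrix.GeneralLinearGroup (Fin k) F}
    (h : ∀ q : BlockOrbit F k, ∃ B ∈ rMonSet H, g • q = B • q) : g ∈ rMonSet H := by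
  classical
  have hcount : ∀ (B : Matrix.GeneralLinearGroup (Fin k) F) (q : BlockOrbit F k),
      ((blockOrbits H).map (B • ·)).count (B • q) = (blockOrbits H).count q :=
    fun B q => Multiset.count_map_eq_count' _ _ (MulAction.injective B) q
  rw [mem_rMonSet_iff]
  ext q
  obtain ⟨q, rfl⟩ := MulAction.surjective g q
  obtain ⟨B, hB, hq⟩ := h q
  change _ = (blockOrbits H).count (g • q)
  rw [hcount, hq, ← hcount B q, mem_rMonSet_iff.1 hB]

/-- For a self-orthogonal `k`-dimensional code `C ⊆ (F_q²)^n` with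
generator matrix `H`, `rMon(C)` is closed for the left `GL_k(F_q)`-action on `O^#` and
`Iso(C)` is closed for the right `GL_k(F_q)`-action on `O`. -/
theorem stmt9 {F : Type*} [Field F] [Fintype F] [DecidableEq F] {k n : ℕ}
    (H : Matrix (Fin k) (Fin n × Fin 2) F)
    (hdim : Function.Injective fun x : Fin k → F => Matrix.vecMul x H)
    (hso : ∀ x y : Fin k → F, sympFormI (Matrix.vecMul x H) (Matrix.vecMul y H) = 0) :
    ClosedOsharp (rMonSet H) ∧ ClosedO (IsoSet H) := by
  refine ⟨closedOsharp_of_subgroup (rMonSubgroup H) fun g h => mem_rMonSet_of_forall_smul_eq h,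
    closedO_of_subgroup (isoSubgroup H) fun g h x => ?_⟩
  obtain ⟨B, hB, u, hx⟩ := h x
  rw [hx, Matrix.smul_vecMul, wtH_units_smul, hB]
end

section
/- There exist a self-orthogonal F_2-linear code C ⊆ (F_2^2)^4 of dimension 3 (with respect to the form ⟨x,y⟩ = Σ_i x_i J y_i^T) and a linear map f: C → (F_2^2)^4 preserving the Hamming weight wt_H and the form ⟨·,·⟩, such that f admits no extension to a linear map g: C^⊥ → (F_2^2)^4 that preserves wt_H and ⟨·,·⟩ on C^⊥ and restricts to f on C. -/
open Matrix

/-- The dual code `C^⊥ = {v : ⟨v,w⟩ = 0 for all w ∈ C}`, as a submodule. -/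
def dualSub {F : Type*} [CommRing F] {ι : Type*} [Fintype ι]
    (C : Submodule F (ι × Fin 2 → F)) : Submodule F (ι × Fin 2 → F) where
  carrier := {v | ∀ w ∈ C, sympFormI v w = 0}
  add_mem' := by
    intro a b ha hb w hw
    have h1 := ha w hw
    have h2 := hb w hw
    unfold sympFormI at *
    calc
      ∑ i, ((a + b) (i, (1 : Fin 2)) * w (i, (0 : Fin 2)) -
            (a + b) (i, (0 : Fin 2)) * w (i, (1 : Fin 2)))
        = ∑ i, ((a (i, (1 : Fin 2)) * w (i, (0 : Fin 2)) -
                 a (i, (0 : Fin 2)) * w (i, (1 : Fin 2))) +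
                (b (i, (1 : Fin 2)) * w (i, (0 : Fin 2)) -
                 b (i, (0 : Fin 2)) * w (i, (1 : Fin 2)))) := by
          refine Finset.sum_congr rfl fun i _ => ?_
          simp only [Pi.add_apply]; ring
      _ = 0 := by rw [Finset.sum_add_distrib, h1, h2, add_zero]
  zero_mem' := by
    intro w hw
    unfold sympFormI
    simp
  smul_mem' := by
    intro c v hv w hw
    have h := hv w hw
    unfold sympFormI at *
    calc
      ∑ i, ((c • v) (i, (1 : Fin 2)) * w (i, (0 : Fin 2)) -
            (c • v) (i, (0 : Fin 2)) * w (i, (1 : Fin 2)))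
        = c * ∑ i, (v (i, (1 : Fin 2)) * w (i, (0 : Fin 2)) -
                    v (i, (0 : Fin 2)) * w (i, (1 : Fin 2))) := by
          rw [Finset.mul_sum]
          refine Finset.sum_congr rfl fun i _ => ?_
          simp only [Pi.smul_apply, smul_eq_mul]; ring
      _ = 0 := by rw [h, mul_zero]

/-- The encoder of the code `C`; its generators are supported on one or two blocks. -/
def encoder : (Fin 3 → ZMod 2) →ₗ[ZMod 2] (Fin 4 × Fin 2 → ZMod 2) where
  toFun c p := ![![c 0, 0], ![0, c 1 + c 2], ![c 1, 0], ![0, c 2]] p.1 p.2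
  map_add' := by decide
  map_smul' := by decide

/-- An encoder with the same weights as `encoder`, in which the second and third generators
are supported on the same two blocks. -/
def encoderImage : (Fin 3 → ZMod 2) →ₗ[ZMod 2] (Fin 4 × Fin 2 → ZMod 2) where
  toFun c p := ![![0, c 0], ![c 2, c 1 + c 2], ![c 2, c 1 + c 2], ![0, 0]] p.1 p.2
  map_add' := by decide
  map_smul' := by decide

lemma encoder_injective : Function.Injective encoder := by
  decide

lemma wtH_encoderImage : ∀ c, wtH (encoderImage c) = wtH (encoder c) := by
  decide

lemma sympFormI_encoder : ∀ c d, sympFormI (encoder c) (encoder d) = 0 := by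
  decide

lemma sympFormI_encoderImage : ∀ c d, sympFormI (encoderImage c) (encoderImage d) = 0 := by
  decide

/-- The vector of weight one in the dual code that cannot be mapped anywhere. -/
def dualVector : Fin 4 × Fin 2 → ZMod 2 := Pi.single (1, 1) 1

lemma sympFormI_dualVector : ∀ c, sympFormI dualVector (encoder c) = 0 := by
  decide

lemma wtH_eq_sum (v : Fin 4 × Fin 2 → ZMod 2) :
    wtH v = (if v (0, 0) = 0 ∧ v (0, 1) = 0 then 0 else 1) +
      (if v (1, 0) = 0 ∧ v (1, 1) = 0 then 0 else 1) +
      (if v (2, 0) = 0 ∧ v (2, 1) = 0 then 0 else 1) +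
      (if v (3, 0) = 0 ∧ v (3, 1) = 0 then 0 else 1) := by
  simp only [wtH, Finset.card_filter, Fin.sum_univ_four, ite_not]

lemma not_wtH_add_encoderImage_eq_one (u : Fin 4 × Fin 2 → ZMod 2) (h₀ : wtH u = 1)
    (h₁ : wtH (u + encoderImage ![0, 1, 0]) = 1)
    (h₂ : wtH (u + encoderImage ![0, 0, 1]) = 1) : False := by
  rw [wtH_eq_sum] at h₀ h₁ h₂
  simp [encoderImage] at h₀ h₁ h₂
  generalize u (0, 0) = a at *
  generalize u (0, 1) = b at *
  generalize u (1, 0) = c at *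
  generalize u (1, 1) = d at *
  generalize u (2, 0) = e at *
  generalize u (2, 1) = f at *
  generalize u (3, 0) = x at *
  generalize u (3, 1) = y at *
  clear u
  revert a b c d e f x y
  decide

/-- There are a self-orthogonal `F₂`-linear code `C ⊆ (F₂²)^4` of
dimension 3 and a linear map `f : C → (F₂²)^4` preserving the Hamming weight and the
symplectic form, such that `f` has no extension to a linear map on `C^⊥` preserving
the Hamming weight and the symplectic form. -/
theorem stmt15 :
    ∃ C : Submodule (ZMod 2) ((Fin 4 × Fin 2) → ZMod 2),
      ∃ hsub : C ≤ dualSub C,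
        Module.finrank (ZMod 2) C = 3 ∧
        ∃ f : C →ₗ[ZMod 2] ((Fin 4 × Fin 2) → ZMod 2),
          (∀ v : C, wtH (f v) = wtH (v : (Fin 4 × Fin 2) → ZMod 2)) ∧
          (∀ v w : C, sympFormI (f v) (f w) =
            sympFormI (v : (Fin 4 × Fin 2) → ZMod 2) (w : (Fin 4 × Fin 2) → ZMod 2)) ∧
          ¬ ∃ g : dualSub C →ₗ[ZMod 2] ((Fin 4 × Fin 2) → ZMod 2),
              (∀ v : dualSub C, wtH (g v) = wtH (v : (Fin 4 × Fin 2) → ZMod 2)) ∧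
              (∀ v w : dualSub C, sympFormI (g v) (g w) =
                sympFormI (v : (Fin 4 × Fin 2) → ZMod 2) (w : (Fin 4 × Fin 2) → ZMod 2)) ∧
              (∀ (v : (Fin 4 × Fin 2) → ZMod 2) (hv : v ∈ C),
                g ⟨v, hsub hv⟩ = f ⟨v, hv⟩) := by
  let φ := LinearEquiv.ofInjective encoder encoder_injective
  have hφ (v : LinearMap.range encoder) : encoder (φ.symm v) = v :=
    congrArg Subtype.val (φ.apply_symm_apply v)
  have hsub : LinearMap.range encoder ≤ dualSub (LinearMap.range encoder) := by
    rintro _ ⟨c, rfl⟩ _ ⟨d, rfl⟩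
    exact sympFormI_encoder c d
  refine ⟨LinearMap.range encoder, hsub, ?_, encoderImage ∘ₗ φ.symm.toLinearMap, ?_, ?_, ?_⟩
  · rw [LinearMap.finrank_range_of_inj encoder_injective, Module.finrank_fin_fun]
  · intro v
    rw [← hφ v]
    exact wtH_encoderImage _
  · intro v w
    rw [← hφ v, ← hφ w, sympFormI_encoder]
    exact sympFormI_encoderImage _ _
  · rintro ⟨g, hwt, -, hext⟩
    have hmem : dualVector ∈ dualSub (LinearMap.range encoder) := by
      rintro _ ⟨c, rfl⟩
      exact sympFormI_dualVector c
    have key (c : Fin 3 → ZMod 2) :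
        wtH (g ⟨dualVector, hmem⟩ + encoderImage c) = wtH (dualVector + encoder c) := by
      have hc : encoder c ∈ LinearMap.range encoder := ⟨c, rfl⟩
      have hg : g ⟨encoder c, hsub hc⟩ = encoderImage c :=
        (hext _ hc).trans (congrArg encoderImage (φ.symm_apply_apply c))
      rw [← hg, ← map_add, hwt]
      rfl
    exact not_wtH_add_encoderImage_eq_one _ ((hwt _).trans (show wtH dualVector = 1 by decide))
      ((key _).trans (by decide)) ((key _).trans (by decide))
end

section
/- Let R = ℤ/dℤ and let C = Ψ(S) and C' = Ψ(S') be stabilizer codes in R^{2n} associated to stabilizers S, S' ≤ P_n. Then C and C' are monomially equivalent (there exists an SL_2(R)-monomial map f of R^{2n} with f(C) = C') if and only if the quantum stabilizer codes Q(S) and Q(S') are LCP equivalent, i.e., there exist a permutation σ ∈ S_n and a local Clifford operator U = U_1 ⊗ ... ⊗ U_n (each U_i ∈ U(d) with U_i P_1 U_i† = P_1) such that S' = U σ(S) U†. -/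
open Matrix

/-- The one-qudit shift operator `X(a)` on `ℂ^d`. -/
noncomputable def XM1 {R : Type*} [CommRing R] [Fintype R] [DecidableEq R] (a : R) :
    Matrix R R ℂ :=
  fun y x => if y = x + a then 1 else 0

/-- The one-qudit phase operator `Z(b)` on `ℂ^d`. -/
noncomputable def ZM1 {R : Type*} [CommRing R] [Fintype R] [DecidableEq R]
    (χ : AddChar R ℂ) (b : R) : Matrix R R ℂ :=
  Matrix.diagonal fun x => χ (b * x)

/-- The one-qudit Pauli group `P₁ = {ω^ℓ X(a)Z(b)}`, as a set of `d × d` matrices. -/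
noncomputable def PauliSet1 {R : Type*} [CommRing R] [Fintype R] [DecidableEq R]
    (χ : AddChar R ℂ) (ω : ℂ) : Set (Matrix R R ℂ) :=
  {M | ∃ (ℓ : ℤ) (a b : R), M = ω ^ ℓ • (XM1 a * ZM1 χ b)}

/-- The Kronecker product `U₁ ⊗ ⋯ ⊗ U_n`, in the basis `{v_x : x ∈ R^n}`. -/
noncomputable def kron {R : Type*} [Fintype R] {n : ℕ} (Us : Fin n → Matrix R R ℂ) :
    Matrix (Fin n → R) (Fin n → R) ℂ :=
  fun x y => ∏ i, Us i (x i) (y i)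

/-- The coordinate-permuted stabilizer `σ(S) = {ω^ℓ X(σ(a)) Z(σ(b)) : ω^ℓ X(a)Z(b) ∈ S}`. -/
noncomputable def permSet {R : Type*} [CommRing R] [Fintype R] [DecidableEq R] {n : ℕ}
    (χ : AddChar R ℂ) (ω : ℂ) (σ : Equiv.Perm (Fin n))
    (S : Set (Matrix (Fin n → R) (Fin n → R) ℂ)) :
    Set (Matrix (Fin n → R) (Fin n → R) ℂ) :=
  {M | ∃ (ℓ : ℤ) (a b : Fin n → R),
        ω ^ ℓ • (XM a * ZM χ b) ∈ S ∧ M = ω ^ ℓ • (XM (a ∘ σ) * ZM χ (b ∘ σ))}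

/-- The `SL₂(R)`-monomial map of `R^{2n}` determined by a permutation `σ` of the `n`
blocks and matrices `A_i`: block `i` of the output is block `σ(i)` of the input,
multiplied as a row vector by `A_i`. -/
def monoPair {R : Type*} [CommRing R] {n : ℕ} (σ : Equiv.Perm (Fin n))
    (A : Fin n → Matrix (Fin 2) (Fin 2) R)
    (v : (Fin n → R) × (Fin n → R)) : (Fin n → R) × (Fin n → R) :=
  (fun i => v.1 (σ i) * A i 0 0 + v.2 (σ i) * A i 1 0,
   fun i => v.1 (σ i) * A i 0 1 + v.2 (σ i) * A i 1 1)

namespace Pauli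

section Kron

variable {R : Type*} [Fintype R] {n : ℕ}

lemma kron_mul (Us Vs : Fin n → Matrix R R ℂ) :
    kron Us * kron Vs = kron fun i => Us i * Vs i := by
  ext x y
  simp only [kron, Matrix.mul_apply, Fintype.prod_sum, Finset.prod_mul_distrib]

lemma conjTranspose_kron (Us : Fin n → Matrix R R ℂ) :
    (kron Us)ᴴ = kron fun i => (Us i)ᴴ := by
  ext x y
  simp [kron, Matrix.conjTranspose_apply]

lemma kron_smul (c : Fin n → ℂ) (Us : Fin n → Matrix R R ℂ) :
    (kron fun i => c i • Us i) = (∏ i, c i) • kron Us := by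
  ext x y
  simp [kron, Finset.prod_mul_distrib]

lemma kron_conj (Us Ps : Fin n → Matrix R R ℂ) :
    kron Us * kron Ps * (kron Us)ᴴ = kron fun i => Us i * Ps i * (Us i)ᴴ := by
  rw [conjTranspose_kron, kron_mul, kron_mul]

lemma kron_one [DecidableEq R] : kron (fun _ : Fin n => (1 : Matrix R R ℂ)) = 1 := by
  ext x y
  simp only [kron, Matrix.one_apply]
  split_ifs with h
  · simp [h]
  · obtain ⟨i, hi⟩ := Function.ne_iff.mp h
    exact Finset.prod_eq_zero (Finset.mem_univ i) (if_neg hi)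

end Kron

section Basic

variable {R : Type*} [CommRing R] [Fintype R] [DecidableEq R] {n : ℕ} (χ : AddChar R ℂ)

/-- The one-qudit Pauli operator `X(a)Z(b)`. -/
noncomputable def pauli1 (a b : R) : Matrix R R ℂ := XM1 a * ZM1 χ b

/-- The Pauli operator `X(a)Z(b)`. -/
noncomputable def pauli (a b : Fin n → R) : Matrix (Fin n → R) (Fin n → R) ℂ := XM a * ZM χ b

lemma pauli1_apply (a b y x : R) : pauli1 χ a b y x = if y = x + a then χ (b * x) else 0 := by
  simp [pauli1, XM1, ZM1, Matrix.mul_diagonal]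

lemma pauli_apply (a b y x : Fin n → R) :
    pauli χ a b y x = if y = x + a then χ (b ⬝ᵥ x) else 0 := by
  simp [pauli, XM, ZM, Matrix.mul_diagonal]

lemma pauli1_zero : pauli1 χ (0 : R) 0 = 1 := by
  ext y x
  simp [pauli1_apply, Matrix.one_apply]

lemma pauli1_mul (a b a' b' : R) :
    pauli1 χ a b * pauli1 χ a' b' = χ (b * a') • pauli1 χ (a + a') (b + b') := by
  ext y x
  simp only [Matrix.mul_apply, pauli1_apply, Matrix.smul_apply, smul_eq_mul]
  rw [Finset.sum_eq_single (x + a')]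
  · by_cases h : y = x + a' + a
    · rw [if_pos h, if_pos rfl, if_pos (by rw [h]; ring), ← AddChar.map_add_eq_mul,
        ← AddChar.map_add_eq_mul]
      ring_nf
    · rw [if_neg h, if_pos rfl, if_neg (fun h' => h (by rw [h', add_assoc, add_comm a']))]
      simp
  · intro z _ hz
    simp [hz]
  · simp

lemma conjTranspose_pauli1 (a b : R) :
    (pauli1 χ a b)ᴴ = χ (b * a) • pauli1 χ (-a) (-b) := by
  ext y x
  simp only [Matrix.conjTranspose_apply, pauli1_apply, Matrix.smul_apply, smul_eq_mul]
  by_cases h : x = y + a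
  · rw [if_pos h, if_pos (by rw [h]; ring), ← AddChar.map_add_eq_mul, ← starRingEnd_apply,
      ← AddChar.map_neg_eq_conj, h]
    ring_nf
  · rw [if_neg h, if_neg (fun h' => h (by rw [h']; ring))]
    simp

lemma pauli1_mem_unitaryGroup (a b : R) : pauli1 χ a b ∈ unitaryGroup R ℂ := by
  rw [mem_unitaryGroup_iff, Matrix.star_eq_conjTranspose, conjTranspose_pauli1,
    Matrix.mul_smul, pauli1_mul, smul_smul, ← AddChar.map_add_eq_mul]
  simp [pauli1_zero]

lemma pauli1_conj (p q a b : R) :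
    pauli1 χ p q * pauli1 χ a b * (pauli1 χ p q)ᴴ = χ (q * a - b * p) • pauli1 χ a b := by
  have h : pauli1 χ p q * pauli1 χ a b =
      χ (q * a - b * p) • (pauli1 χ a b * pauli1 χ p q) := by
    rw [pauli1_mul, pauli1_mul, smul_smul, ← AddChar.map_add_eq_mul, add_comm a, add_comm b]
    ring_nf
  rw [h, Matrix.smul_mul, Matrix.mul_assoc, ← Matrix.star_eq_conjTranspose,
    mem_unitaryGroup_iff.mp (pauli1_mem_unitaryGroup χ p q), Matrix.mul_one]

lemma smul_pauli1_cancel {c c' : ℂ} {a b : R} (h : c • pauli1 χ a b = c' • pauli1 χ a b) :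
    c = c' := by
  have := congrFun (congrFun h a) 0
  simpa [pauli1_apply] using this

lemma pauli1_pow (a b : R) (k : ℕ) :
    pauli1 χ a b ^ k = χ (k.choose 2 * (b * a)) • pauli1 χ (k * a) (k * b) := by
  induction k with
  | zero => simp [pauli1_zero]
  | succ k ih =>
    rw [pow_succ, ih, Matrix.smul_mul, pauli1_mul, smul_smul, ← AddChar.map_add_eq_mul,
      Nat.choose_succ_succ' k 1]
    push_cast
    rw [Nat.choose_one_right]
    ring_nf

omit [Fintype R] [DecidableEq R] in
lemma map_sum_eq_prod (f : Fin n → R) : χ (∑ i, f i) = ∏ i, χ (f i) :=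
  map_prod χ.toMonoidHom (fun i => Multiplicative.ofAdd (f i)) Finset.univ

omit [Fintype R] [DecidableEq R] in
lemma map_dotProduct (u v : Fin n → R) : χ (u ⬝ᵥ v) = ∏ i, χ (u i * v i) :=
  map_sum_eq_prod χ _

lemma pauli_eq_kron (a b : Fin n → R) :
    pauli χ a b = kron fun i => pauli1 χ (a i) (b i) := by
  ext y x
  simp only [pauli_apply, kron, pauli1_apply]
  split_ifs with h
  · subst h
    simp [map_dotProduct]
  · obtain ⟨i, hi⟩ := Function.ne_iff.mp h
    exact (Finset.prod_eq_zero (Finset.mem_univ i) (if_neg hi)).symm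

lemma pauli_mul (a b a' b' : Fin n → R) :
    pauli χ a b * pauli χ a' b' = χ (b ⬝ᵥ a') • pauli χ (a + a') (b + b') := by
  simp only [pauli_eq_kron, kron_mul, pauli1_mul, kron_smul, map_dotProduct, Pi.add_apply]

lemma pauli_conj (p q a b : Fin n → R) :
    pauli χ p q * pauli χ a b * (pauli χ p q)ᴴ = χ (q ⬝ᵥ a - b ⬝ᵥ p) • pauli χ a b := by
  simp only [pauli_eq_kron, kron_conj, pauli1_conj, kron_smul]
  rw [dotProduct, dotProduct, ← Finset.sum_sub_distrib, map_sum_eq_prod]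

lemma pauli_zero : pauli χ (0 : Fin n → R) 0 = 1 := by
  ext y x
  simp [pauli_apply, Matrix.one_apply]

lemma smul_pauli_cancel (hχ : Function.Injective χ) {c c' : ℂ} (hc : c ≠ 0)
    {a b a' b' : Fin n → R} (h : c • pauli χ a b = c' • pauli χ a' b') :
    c = c' ∧ a = a' ∧ b = b' := by
  have h₀ := congrFun (congrFun h a) 0
  have ha : a = a' := by
    by_contra hne
    simp [pauli_apply, hne, hc] at h₀
  subst ha
  have hcc : c = c' := by simpa [pauli_apply] using h₀
  subst hcc
  refine ⟨rfl, rfl, funext fun i => hχ ?_⟩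
  have := congrFun (congrFun h (Pi.single i 1 + a)) (Pi.single i 1)
  simpa [pauli_apply, hc] using this

end Basic

section Character

variable {d : ℕ} [NeZero d] {χ : AddChar (ZMod d) ℂ}

lemma map_eq_pow (x : ZMod d) : χ x = χ 1 ^ x.val := by
  rw [← AddChar.map_nsmul_eq_pow, nsmul_one, ZMod.natCast_rightInverse]

lemma injective_of_isPrimitiveRoot (hχ : IsPrimitiveRoot (χ 1) d) : Function.Injective χ := by
  intro x y h
  rw [map_eq_pow x, map_eq_pow y] at h
  exact ZMod.val_injective d (hχ.pow_inj (ZMod.val_lt x) (ZMod.val_lt y) h)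

lemma exists_eq_map_mul (hχ : IsPrimitiveRoot (χ 1) d) (ψ : AddChar (ZMod d) ℂ) :
    ∃ r, ∀ x, ψ x = χ (r * x) := by
  have h : ψ 1 ^ d = 1 := by
    rw [← AddChar.map_nsmul_eq_pow, nsmul_one, ZMod.natCast_self, AddChar.map_zero_eq_one]
  obtain ⟨k, -, hk⟩ := hχ.eq_pow_of_pow_eq_one h
  refine ⟨k, fun x => ?_⟩
  rw [map_eq_pow x, ← hk, ← AddChar.map_nsmul_eq_pow, ← AddChar.map_nsmul_eq_pow, nsmul_one,
    nsmul_eq_mul, ZMod.natCast_rightInverse x, mul_comm]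

lemma exists_eq_map_dotProduct (hχ : IsPrimitiveRoot (χ 1) d) {n : ℕ}
    (ψ : AddChar (Fin n → ZMod d) ℂ) : ∃ r, ∀ v, ψ v = χ (r ⬝ᵥ v) := by
  choose r hr using fun i =>
    exists_eq_map_mul hχ (ψ.compAddMonoidHom (AddMonoidHom.single (fun _ => ZMod d) i))
  refine ⟨r, fun v => ?_⟩
  simp only [map_dotProduct, ← hr]
  conv_lhs => rw [← Finset.univ_sum_single v]
  exact map_prod ψ.toMonoidHom (fun i => Multiplicative.ofAdd (Pi.single i (v i))) Finset.univ

/-- A character of a subgroup of `R^n × R^n` is given by a vector of `R^n × R^n`. -/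
lemma exists_dotProduct_of_mul (hχ : IsPrimitiveRoot (χ 1) d) {n : ℕ}
    (H : AddSubgroup ((Fin n → ZMod d) × (Fin n → ZMod d)))
    (μ : (Fin n → ZMod d) × (Fin n → ZMod d) → ℂ) (h₀ : ∀ v ∈ H, μ v ≠ 0)
    (hμ : ∀ v ∈ H, ∀ w ∈ H, μ (v + w) = μ v * μ w) :
    ∃ p q, ∀ v ∈ H, μ v = χ (p ⬝ᵥ v.1 + q ⬝ᵥ v.2) := by
  let φ : AddSubgroup.toSubgroup H →* ℂˣ := MonoidHom.mk'
    (fun v => Units.mk0 (μ v.1.toAdd) (h₀ _ v.2))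
    (fun v w => Units.ext (hμ _ v.2 _ w.2))
  have : NeZero (Monoid.exponent (Multiplicative ((Fin n → ZMod d) × (Fin n → ZMod d)))) :=
    ⟨Monoid.exponent_ne_zero_of_finite⟩
  obtain ⟨Φ, hΦ⟩ := MonoidHom.domRestrict_surjective ℂ (AddSubgroup.toSubgroup H) φ
  let ψ : AddChar ((Fin n → ZMod d) × (Fin n → ZMod d)) ℂ :=
    AddChar.toMonoidHomEquiv.symm ((Units.coeHom ℂ).comp Φ)
  obtain ⟨p, hp⟩ := exists_eq_map_dotProduct hχ (ψ.compAddMonoidHom (AddMonoidHom.inl _ _))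
  obtain ⟨q, hq⟩ := exists_eq_map_dotProduct hχ (ψ.compAddMonoidHom (AddMonoidHom.inr _ _))
  refine ⟨p, q, fun v hv => ?_⟩
  rw [AddChar.map_add_eq_mul, ← hp, ← hq]
  have hψ : μ v = ψ v := by
    have hv' := congrArg Units.val
      (DFunLike.congr_fun hΦ (⟨Multiplicative.ofAdd v, hv⟩ : AddSubgroup.toSubgroup H))
    exact hv'.symm
  rw [hψ, AddChar.compAddMonoidHom_apply, AddChar.compAddMonoidHom_apply,
    ← AddChar.map_add_eq_mul]
  simp

end Character

section Clifford

variable {d : ℕ} [NeZero d] {χ : AddChar (ZMod d) ℂ}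

/-- Conjugation by `U` sends `X(a)Z(b)` to a phase times `X(a')Z(b')`, `(a', b') = (a, b) A`. -/
def ActsBy (χ : AddChar (ZMod d) ℂ) (ω : ℂ) (U : Matrix (ZMod d) (ZMod d) ℂ)
    (A : Matrix (Fin 2) (Fin 2) (ZMod d)) : Prop :=
  ∀ a b, ∃ ℓ : ℤ, U * pauli1 χ a b * Uᴴ =
    ω ^ ℓ • pauli1 χ (a * A 0 0 + b * A 1 0) (a * A 0 1 + b * A 1 1)

lemma conj_mul_conj {m : Type*} [Fintype m] [DecidableEq m] {U : Matrix m m ℂ}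
    (hU : Uᴴ * U = 1) (P Q : Matrix m m ℂ) : U * (P * Q) * Uᴴ = U * P * Uᴴ * (U * Q * Uᴴ) := by
  calc U * (P * Q) * Uᴴ = U * P * 1 * Q * Uᴴ := by simp only [Matrix.mul_one, Matrix.mul_assoc]
    _ = _ := by simp only [← hU, Matrix.mul_assoc]

lemma actsBy_of_generators {ω : ℂ} (hω : ω ≠ 0) (hphase : ∀ x, ∃ ℓ : ℤ, χ x = ω ^ ℓ)
    {U : Matrix (ZMod d) (ZMod d) ℂ} (hU : U ∈ unitaryGroup (ZMod d) ℂ)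
    {A : Matrix (Fin 2) (Fin 2) (ZMod d)} {k l : ℤ}
    (hX : U * pauli1 χ 1 0 * Uᴴ = ω ^ k • pauli1 χ (A 0 0) (A 0 1))
    (hZ : U * pauli1 χ 0 1 * Uᴴ = ω ^ l • pauli1 χ (A 1 0) (A 1 1)) : ActsBy χ ω U A := by
  let T : ZMod d → ZMod d → Prop := fun a b => ∃ ℓ : ℤ, U * pauli1 χ a b * Uᴴ =
    ω ^ ℓ • pauli1 χ (a * A 0 0 + b * A 1 0) (a * A 0 1 + b * A 1 1)
  have hadd : ∀ a b a' b', T a b → T a' b' → T (a + a') (b + b') := by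
    rintro a b a' b' ⟨ℓ, h⟩ ⟨ℓ', h'⟩
    have hp : pauli1 χ (a + a') (b + b') = χ (-(b * a')) • (pauli1 χ a b * pauli1 χ a' b') := by
      rw [pauli1_mul, smul_smul, ← AddChar.map_add_eq_mul]
      simp
    obtain ⟨s, hs⟩ := hphase (-(b * a'))
    obtain ⟨t, ht⟩ := hphase ((a * A 0 1 + b * A 1 1) * (a' * A 0 0 + b' * A 1 0))
    refine ⟨s + ℓ + ℓ' + t, ?_⟩
    rw [hp, Matrix.mul_smul, Matrix.smul_mul, conj_mul_conj (mem_unitaryGroup_iff'.mp hU), h, h',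
      Matrix.smul_mul, Matrix.mul_smul, pauli1_mul, hs, ht, smul_smul, smul_smul, smul_smul,
      zpow_add₀ hω, zpow_add₀ hω, zpow_add₀ hω]
    ring_nf
  have h0 : T 0 0 := ⟨0, by simpa [pauli1_zero, Matrix.star_eq_conjTranspose] using mem_unitaryGroup_iff.mp hU⟩
  have hXk : ∀ j : ℕ, T j 0 := by
    intro j
    induction j with
    | zero => simpa using h0
    | succ j ih => simpa using hadd _ _ _ _ ih (show T 1 0 from ⟨k, by simpa using hX⟩)
  have hZk : ∀ j : ℕ, T 0 j := by
    intro j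
    induction j with
    | zero => simpa using h0
    | succ j ih => simpa using hadd _ _ _ _ ih (show T 0 1 from ⟨l, by simpa using hZ⟩)
  intro a b
  simpa [T] using hadd _ _ _ _ (hXk a.val) (hZk b.val)

lemma ActsBy.image_pauliSet1 {ω : ℂ} (hω : ω ≠ 0) {U : Matrix (ZMod d) (ZMod d) ℂ}
    {A : Matrix (Fin 2) (Fin 2) (ZMod d)} (hA : A.det = 1) (h : ActsBy χ ω U A) :
    (fun P => U * P * Uᴴ) '' PauliSet1 χ ω = PauliSet1 χ ω := by
  rw [Matrix.det_fin_two] at hA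
  apply Set.Subset.antisymm
  · rintro _ ⟨_, ⟨ℓ, a, b, rfl⟩, rfl⟩
    obtain ⟨m, hm⟩ := h a b
    refine ⟨ℓ + m, a * A 0 0 + b * A 1 0, a * A 0 1 + b * A 1 1, ?_⟩
    change U * (ω ^ ℓ • pauli1 χ a b) * Uᴴ = _
    rw [Matrix.mul_smul, Matrix.smul_mul, hm, smul_smul, zpow_add₀ hω]
    rfl
  · rintro _ ⟨ℓ, a, b, rfl⟩
    obtain ⟨m, hm⟩ := h (a * A 1 1 - b * A 1 0) (b * A 0 0 - a * A 0 1)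
    refine ⟨ω ^ (ℓ - m) • pauli1 χ (a * A 1 1 - b * A 1 0) (b * A 0 0 - a * A 0 1),
      ⟨_, _, _, rfl⟩, ?_⟩
    have ha : (a * A 1 1 - b * A 1 0) * A 0 0 + (b * A 0 0 - a * A 0 1) * A 1 0 = a := by
      linear_combination a * hA
    have hb : (a * A 1 1 - b * A 1 0) * A 0 1 + (b * A 0 0 - a * A 0 1) * A 1 1 = b := by
      linear_combination b * hA
    rw [ha, hb] at hm
    change U * (ω ^ (ℓ - m) • pauli1 χ _ _) * Uᴴ = ω ^ ℓ • pauli1 χ a b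
    rw [Matrix.mul_smul, Matrix.smul_mul, hm, smul_smul, ← zpow_add₀ hω, sub_add_cancel]

/-- A local Clifford operator acts on `R²` by a matrix of determinant one. -/
lemma exists_actsBy_of_image (hχ : IsPrimitiveRoot (χ 1) d) {ω : ℂ} (hω : ω ≠ 0)
    (hphase : ∀ x, ∃ ℓ : ℤ, χ x = ω ^ ℓ) {U : Matrix (ZMod d) (ZMod d) ℂ}
    (hU : U ∈ unitaryGroup (ZMod d) ℂ)
    (h : (fun P => U * P * Uᴴ) '' PauliSet1 χ ω = PauliSet1 χ ω) :
    ∃ A : Matrix (Fin 2) (Fin 2) (ZMod d), A.det = 1 ∧ ActsBy χ ω U A := by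
  have hmaps : ∀ a b, ∃ (ℓ : ℤ) (a' b' : ZMod d),
      U * pauli1 χ a b * Uᴴ = ω ^ ℓ • pauli1 χ a' b' := fun a b =>
    h.subset ⟨pauli1 χ a b, ⟨0, a, b, by simp [pauli1]⟩, rfl⟩
  obtain ⟨k, p, q, hX⟩ := hmaps 1 0
  obtain ⟨l, r, s, hZ⟩ := hmaps 0 1
  refine ⟨!![p, q; r, s], ?_, actsBy_of_generators hω hphase hU hX hZ⟩
  have hcomm : pauli1 χ 0 1 * pauli1 χ 1 0 = χ 1 • (pauli1 χ 1 0 * pauli1 χ 0 1) := by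
    simp [pauli1_mul]
  have hconj : ω ^ l • pauli1 χ r s * ω ^ k • pauli1 χ p q =
      χ 1 • (ω ^ k • pauli1 χ p q * ω ^ l • pauli1 χ r s) := by
    have hU' := mem_unitaryGroup_iff'.mp hU
    rw [← hX, ← hZ, ← conj_mul_conj hU', ← conj_mul_conj hU', hcomm, Matrix.mul_smul,
      Matrix.smul_mul]
  simp only [Matrix.mul_smul, Matrix.smul_mul, pauli1_mul, smul_smul] at hconj
  rw [add_comm r p, add_comm s q] at hconj
  have hc := smul_pauli1_cancel χ hconj
  have hk : ω ^ k * ω ^ l ≠ 0 := mul_ne_zero (zpow_ne_zero _ hω) (zpow_ne_zero _ hω)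
  have hc' : χ (s * p) = χ (1 + q * r) := by
    rw [AddChar.map_add_eq_mul]
    apply mul_left_cancel₀ hk
    linear_combination hc
  have := injective_of_isPrimitiveRoot hχ hc'
  rw [Matrix.det_fin_two_of]
  linear_combination this

end Clifford

section Intertwiner

variable {d : ℕ} [NeZero d] {χ : AddChar (ZMod d) ℂ}

lemma star_mulVec_dotProduct_mulVec {m : Type*} [Fintype m] [DecidableEq m] {M : Matrix m m ℂ}
    (hM : M ∈ unitaryGroup m ℂ) (u w : m → ℂ) : star (M *ᵥ u) ⬝ᵥ (M *ᵥ w) = star u ⬝ᵥ w := by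
  rw [Matrix.star_mulVec, Matrix.dotProduct_mulVec, Matrix.vecMul_vecMul,
    ← Matrix.star_eq_conjTranspose, mem_unitaryGroup_iff'.mp hM, Matrix.vecMul_one]

lemma exists_smul_star_dotProduct_eq_one {m : Type*} [Fintype m] {v : m → ℂ} (hv : v ≠ 0) :
    ∃ c : ℂ, star (c • v) ⬝ᵥ (c • v) = 1 := by
  have hpos : 0 < ∑ i, ‖v i‖ ^ 2 := by
    obtain ⟨i, hi⟩ := Function.ne_iff.mp hv
    exact Finset.sum_pos' (fun _ _ => by positivity)
      ⟨i, Finset.mem_univ i, pow_pos (norm_pos_iff.mpr hi) 2⟩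
  have hsum : star v ⬝ᵥ v = ((∑ i, ‖v i‖ ^ 2 : ℝ) : ℂ) := by
    simp [dotProduct, Complex.conj_mul']
  refine ⟨((Real.sqrt (∑ i, ‖v i‖ ^ 2))⁻¹ : ℝ), ?_⟩
  rw [star_smul, smul_dotProduct, dotProduct_smul, hsum, Complex.star_def, Complex.conj_ofReal,
    smul_eq_mul, smul_eq_mul, ← Complex.ofReal_mul, ← Complex.ofReal_mul, ← mul_assoc, ← mul_inv,
    Real.mul_self_sqrt hpos.le, inv_mul_cancel₀ hpos.ne', Complex.ofReal_one]

section

variable {X Z : Matrix (ZMod d) (ZMod d) ℂ}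

lemma mul_pow_of_weyl (hZX : Z * X = χ 1 • (X * Z)) (k : ℕ) :
    Z * X ^ k = χ 1 ^ k • (X ^ k * Z) := by
  induction k with
  | zero => simp
  | succ k ih =>
    rw [pow_succ, ← Matrix.mul_assoc, ih, Matrix.smul_mul, Matrix.mul_assoc, hZX,
      Matrix.mul_smul, smul_smul, pow_succ, Matrix.mul_assoc]

lemma exists_fixed_vector_of_weyl (hχ : IsPrimitiveRoot (χ 1) d) (hX : X ^ d = 1) (hZ : Z ^ d = 1)
    (hZX : Z * X = χ 1 • (X * Z)) : ∃ v, v ≠ 0 ∧ Z *ᵥ v = v := by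
  obtain ⟨μ, hμ⟩ := Module.End.exists_eigenvalue (Matrix.toLin' Z)
  obtain ⟨v, hv⟩ := hμ.exists_hasEigenvector
  have hZv : Z *ᵥ v = μ • v := by simpa using hv.apply_eq_smul
  have hpow : ∀ k : ℕ, Z ^ k *ᵥ v = μ ^ k • v := by
    intro k
    induction k with
    | zero => simp
    | succ k ih => rw [pow_succ, ← Matrix.mulVec_mulVec, hZv, Matrix.mulVec_smul, ih, smul_smul,
        pow_succ, mul_comm]
  have hμd : μ ^ d = 1 := by
    have h := hpow d
    rw [hZ, Matrix.one_mulVec] at h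
    have h' : (μ ^ d - 1) • v = 0 := by rw [sub_smul, ← h, one_smul, sub_self]
    exact sub_eq_zero.mp ((smul_eq_zero.mp h').resolve_right hv.2)
  obtain ⟨i, hi, hχμ⟩ := hχ.eq_pow_of_pow_eq_one hμd
  refine ⟨X ^ (d - i) *ᵥ v, fun h0 => hv.2 ?_, ?_⟩
  · have h := congrArg (X ^ i *ᵥ ·) h0
    simpa [Matrix.mulVec_mulVec, ← pow_add, Nat.add_sub_cancel' hi.le, hX] using h
  · rw [Matrix.mulVec_mulVec, mul_pow_of_weyl hZX, Matrix.smul_mulVec, ← Matrix.mulVec_mulVec, hZv,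
      Matrix.mulVec_smul, smul_smul, ← hχμ, ← pow_add, Nat.sub_add_cancel hi.le, hχ.pow_eq_one,
      one_smul]

/-- Uniqueness of the Weyl commutation relation, for unitaries of order dividing `d`. -/
lemma exists_unitary_of_weyl (hχ : IsPrimitiveRoot (χ 1) d) (hXU : X ∈ unitaryGroup (ZMod d) ℂ)
    (hZU : Z ∈ unitaryGroup (ZMod d) ℂ) (hX : X ^ d = 1) (hZ : Z ^ d = 1)
    (hZX : Z * X = χ 1 • (X * Z)) :
    ∃ U ∈ unitaryGroup (ZMod d) ℂ, U * pauli1 χ 1 0 * Uᴴ = X ∧ U * pauli1 χ 0 1 * Uᴴ = Z := by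
  obtain ⟨v₀, hv₀, hZv₀⟩ := exists_fixed_vector_of_weyl hχ hX hZ hZX
  obtain ⟨c, hc⟩ := exists_smul_star_dotProduct_eq_one hv₀
  set v := c • v₀
  have hZv : Z *ᵥ v = v := by rw [Matrix.mulVec_smul, hZv₀]
  let u : ZMod d → ZMod d → ℂ := fun x => X ^ x.val *ᵥ v
  have hZu : ∀ x, Z *ᵥ u x = χ x • u x := by
    intro x
    rw [Matrix.mulVec_mulVec, mul_pow_of_weyl hZX, Matrix.smul_mulVec, ← Matrix.mulVec_mulVec, hZv,
      ← map_eq_pow]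
  have hXu : ∀ x, X *ᵥ u x = u (x + 1) := by
    intro x
    have hpow : X ^ (x + 1).val = X ^ (x.val + 1) := by
      conv_rhs => rw [pow_eq_pow_mod _ hX]
      rw [ZMod.val_add, ZMod.val_one_eq_one_mod, Nat.add_mod_mod]
    rw [Matrix.mulVec_mulVec, ← pow_succ', ← hpow]
  have horth : ∀ x y, star (u x) ⬝ᵥ u y = if x = y then 1 else 0 := by
    intro x y
    split_ifs with h
    · subst h
      rw [star_mulVec_dotProduct_mulVec (pow_mem hXU _), hc]
    · have h1 := star_mulVec_dotProduct_mulVec hZU (u x) (u y)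
      rw [hZu, hZu, star_smul, smul_dotProduct, dotProduct_smul, smul_smul, ← starRingEnd_apply,
        ← AddChar.map_neg_eq_conj, ← AddChar.map_add_eq_mul, smul_eq_mul] at h1
      have hne : χ (-x + y) ≠ 1 := fun h2 => h <| by
        rw [← AddChar.map_zero_eq_one χ] at h2
        linear_combination -injective_of_isPrimitiveRoot hχ h2
      have h3 : (χ (-x + y) - 1) * (star (u x) ⬝ᵥ u y) = 0 := by linear_combination h1
      exact (mul_eq_zero.mp h3).resolve_left (sub_ne_zero.mpr hne)
  let U : Matrix (ZMod d) (ZMod d) ℂ := Matrix.of fun y x => u x y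
  have hU : U ∈ unitaryGroup (ZMod d) ℂ := by
    rw [mem_unitaryGroup_iff']
    ext x y
    exact (horth x y).trans (Matrix.one_apply).symm
  have hUU : U * Uᴴ = 1 := mem_unitaryGroup_iff.mp hU
  refine ⟨U, hU, ?_, ?_⟩
  · have h : U * pauli1 χ 1 0 = X * U := by
      ext y x
      refine Eq.trans ?_ (congrFun (hXu x) y).symm
      simp [Matrix.mul_apply, pauli1_apply, U]
    rw [h, Matrix.mul_assoc, hUU, Matrix.mul_one]
  · have h : U * pauli1 χ 0 1 = Z * U := by
      ext y x
      refine Eq.trans ?_ (congrFun (hZu x) y).symm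
      simp [Matrix.mul_apply, pauli1_apply, U, mul_comm]
    rw [h, Matrix.mul_assoc, hUU, Matrix.mul_one]

end

lemma exists_zpow_smul_pauli1_pow_eq_one {ω : ℂ}
    (hω : IsPrimitiveRoot ω (if d % 2 = 1 then d else 2 * d)) (a b : ZMod d) :
    ∃ ℓ : ℤ, (ω ^ ℓ • pauli1 χ a b) ^ d = 1 := by
  set s := χ (d.choose 2 * (b * a)) with hs
  have hpow : pauli1 χ a b ^ d = s • 1 := by
    rw [pauli1_pow, ← pauli1_zero χ, ZMod.natCast_self, zero_mul, zero_mul]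
  have hsq : s ^ 2 = 1 := by
    have h2 : 2 * d.choose 2 = d * (d - 1) := by
      rw [Nat.choose_two_right, Nat.mul_div_cancel' (Nat.even_mul_pred_self d).two_dvd]
    have h2' : (2 : ZMod d) * (d.choose 2 : ZMod d) = 0 := by
      have := congrArg (Nat.cast : ℕ → ZMod d) h2
      simpa using this
    rw [hs, ← AddChar.map_nsmul_eq_pow, nsmul_eq_mul, Nat.cast_ofNat, ← mul_assoc, h2', zero_mul,
      AddChar.map_zero_eq_one]
  have hsd : s ^ d = 1 := by
    rw [hs, ← AddChar.map_nsmul_eq_pow, nsmul_eq_mul, ZMod.natCast_self, zero_mul,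
      AddChar.map_zero_eq_one]
  rcases eq_or_eq_neg_of_sq_eq_sq s 1 (by rw [hsq, one_pow]) with h | h
  · exact ⟨0, by rw [zpow_zero, one_smul, hpow, h, one_smul]⟩
  · rcases Nat.even_or_odd d with hd | hd
    · rw [if_neg (by rw [Nat.even_iff.mp hd]; decide)] at hω
      have hωd : ω ^ d = -1 :=
        (hω.pow (Nat.mul_pos two_pos (NeZero.pos d)) (mul_comm 2 d)).eq_neg_one_of_two_right
      exact ⟨1, by rw [zpow_one, smul_pow, hωd, hpow, h, smul_smul]; simp⟩
    · rw [h, hd.neg_one_pow] at hsd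
      norm_num at hsd

/-- Every element of `SL₂(R)` is induced by a Clifford operator. -/
lemma exists_unitary_actsBy (hχ : IsPrimitiveRoot (χ 1) d) {ω : ℂ}
    (hω : IsPrimitiveRoot ω (if d % 2 = 1 then d else 2 * d))
    (hphase : ∀ x, ∃ ℓ : ℤ, χ x = ω ^ ℓ) {A : Matrix (Fin 2) (Fin 2) (ZMod d)}
    (hA : A.det = 1) : ∃ U ∈ unitaryGroup (ZMod d) ℂ, ActsBy χ ω U A := by
  have hN : (if d % 2 = 1 then d else 2 * d) ≠ 0 := by
    have := NeZero.ne d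
    split_ifs <;> simpa
  have hω0 : ω ≠ 0 := hω.ne_zero hN
  have hstar : star ω * ω = 1 := by
    rw [Complex.star_def, Complex.conj_mul', hω.norm'_eq_one hN]
    simp
  obtain ⟨k, hk⟩ := exists_zpow_smul_pauli1_pow_eq_one (χ := χ) hω (A 0 0) (A 0 1)
  obtain ⟨l, hl⟩ := exists_zpow_smul_pauli1_pow_eq_one (χ := χ) hω (A 1 0) (A 1 1)
  have hunit : ∀ (m : ℤ) a b, ω ^ m • pauli1 χ a b ∈ unitaryGroup (ZMod d) ℂ := by
    intro m a b
    rw [mem_unitaryGroup_iff', star_smul, Matrix.smul_mul, Matrix.mul_smul, smul_smul,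
      mem_unitaryGroup_iff'.mp (pauli1_mem_unitaryGroup χ a b), star_zpow₀, ← mul_zpow, hstar,
      _root_.one_zpow, one_smul]
  have hweyl : ω ^ l • pauli1 χ (A 1 0) (A 1 1) * ω ^ k • pauli1 χ (A 0 0) (A 0 1) =
      χ 1 • (ω ^ k • pauli1 χ (A 0 0) (A 0 1) * ω ^ l • pauli1 χ (A 1 0) (A 1 1)) := by
    rw [Matrix.det_fin_two] at hA
    have hdet : A 1 1 * A 0 0 = 1 + A 0 1 * A 1 0 := by linear_combination hA
    simp only [Matrix.smul_mul, Matrix.mul_smul, pauli1_mul, smul_smul]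
    rw [hdet, AddChar.map_add_eq_mul, add_comm (A 1 0), add_comm (A 1 1)]
    ring_nf
  obtain ⟨U, hU, hX, hZ⟩ := exists_unitary_of_weyl hχ (hunit k _ _) (hunit l _ _) hk hl hweyl
  exact ⟨U, hU, actsBy_of_generators hω0 hphase hU hX hZ⟩

end Intertwiner

section Stabilizer

variable {d : ℕ} [NeZero d] {χ : AddChar (ZMod d) ℂ} {n : ℕ} {ω : ℂ}

lemma ActsBy.mul_pauli1 (hω : ω ≠ 0) (hphase : ∀ x, ∃ ℓ : ℤ, χ x = ω ^ ℓ)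
    {U : Matrix (ZMod d) (ZMod d) ℂ} {A : Matrix (Fin 2) (Fin 2) (ZMod d)}
    (h : ActsBy χ ω U A) (p q : ZMod d) : ActsBy χ ω (U * pauli1 χ p q) A := by
  intro a b
  obtain ⟨ℓ, hℓ⟩ := h a b
  obtain ⟨m, hm⟩ := hphase (q * a - b * p)
  refine ⟨m + ℓ, ?_⟩
  calc U * pauli1 χ p q * pauli1 χ a b * (U * pauli1 χ p q)ᴴ
      = U * (pauli1 χ p q * pauli1 χ a b * (pauli1 χ p q)ᴴ) * Uᴴ := by
        simp only [Matrix.conjTranspose_mul, Matrix.mul_assoc]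
    _ = _ := by
        rw [pauli1_conj, Matrix.mul_smul, Matrix.smul_mul, hℓ, smul_smul, hm, zpow_add₀ hω]

lemma exists_kron_conj_pauli (hω : ω ≠ 0) {Us : Fin n → Matrix (ZMod d) (ZMod d) ℂ}
    {A : Fin n → Matrix (Fin 2) (Fin 2) (ZMod d)} (h : ∀ i, ActsBy χ ω (Us i) (A i))
    (σ : Equiv.Perm (Fin n)) (v : (Fin n → ZMod d) × (Fin n → ZMod d)) :
    ∃ ℓ : ℤ, kron Us * pauli χ (v.1 ∘ σ) (v.2 ∘ σ) * (kron Us)ᴴ =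
      ω ^ ℓ • pauli χ (monoPair σ A v).1 (monoPair σ A v).2 := by
  choose ℓ hℓ using fun i => h i (v.1 (σ i)) (v.2 (σ i))
  refine ⟨∑ i, ℓ i, ?_⟩
  have hprod : ω ^ (∑ i, ℓ i) = ∏ i, ω ^ ℓ i := by
    induction (Finset.univ : Finset (Fin n)) using Finset.cons_induction with
    | empty => simp
    | cons i s hi ih => rw [Finset.sum_cons, Finset.prod_cons, zpow_add₀ hω, ih]
  rw [pauli_eq_kron, kron_conj, pauli_eq_kron, hprod, ← kron_smul]
  exact congrArg kron (funext hℓ)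

omit [NeZero d] in
lemma monoPair_add (σ : Equiv.Perm (Fin n)) (A : Fin n → Matrix (Fin 2) (Fin 2) (ZMod d))
    (v w : (Fin n → ZMod d) × (Fin n → ZMod d)) :
    monoPair σ A (v + w) = monoPair σ A v + monoPair σ A w := by
  ext i <;> simp only [monoPair, Prod.fst_add, Prod.snd_add, Pi.add_apply] <;> ring

section

variable {S : Set (Matrix (Fin n → ZMod d) (Fin n → ZMod d) ℂ)}

lemma eq_of_smul_pauli_mem (hχ : Function.Injective χ) (hω : ω ≠ 0) (hS : IsStabilizer χ ω S)
    {c c' : ℂ} (hc : c ≠ 0) (hc' : c' ≠ 0) {a b : Fin n → ZMod d}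
    (h : c • pauli χ a b ∈ S) (h' : c' • pauli χ a b ∈ S) : c = c' := by
  obtain ⟨hP, -, hmul, -, hinv, hker⟩ := hS
  have hpow : ∀ {c : ℂ}, c ≠ 0 → c • pauli χ a b ∈ S → ∃ ℓ : ℤ, c = ω ^ ℓ := by
    intro c hc h
    obtain ⟨ℓ, a', b', hℓ⟩ := hP h
    exact ⟨ℓ, (smul_pauli_cancel χ hχ hc hℓ).1⟩
  obtain ⟨ℓ, rfl⟩ := hpow hc h
  obtain ⟨m, rfl⟩ := hpow hc' h'
  obtain ⟨Q, hQ, hQ1⟩ := hinv _ h'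
  have hPQ : ω ^ ℓ • pauli χ a b * Q = ω ^ (ℓ - m) • 1 := by
    rw [← hQ1, Matrix.smul_mul, Matrix.smul_mul, smul_smul, ← zpow_add₀ hω, sub_add_cancel]
  have hPQ1 := hker _ (hmul _ h _ hQ) ⟨_, hPQ⟩
  have heq : ω ^ ℓ • pauli χ a b = ω ^ m • pauli χ a b :=
    calc ω ^ ℓ • pauli χ a b = ω ^ ℓ • pauli χ a b * (Q * ω ^ m • pauli χ a b) := by
          rw [mul_eq_one_comm.mp hQ1, Matrix.mul_one]
      _ = ω ^ m • pauli χ a b := by rw [← Matrix.mul_assoc, hPQ1, Matrix.one_mul]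
  exact (smul_pauli_cancel χ hχ hc heq).1

lemma phase_add (hχ : Function.Injective χ) (hω : ω ≠ 0) (hS : IsStabilizer χ ω S)
    {c c' c'' : ℂ} (hc : c ≠ 0) (hc' : c' ≠ 0) (hc'' : c'' ≠ 0)
    {v w : (Fin n → ZMod d) × (Fin n → ZMod d)}
    (hv : c • pauli χ v.1 v.2 ∈ S) (hw : c' • pauli χ w.1 w.2 ∈ S)
    (hvw : c'' • pauli χ (v + w).1 (v + w).2 ∈ S) : c'' = c * c' * χ (v.2 ⬝ᵥ w.1) := by
  have h := hS.2.2.1 _ hv _ hw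
  rw [Matrix.smul_mul, Matrix.mul_smul, pauli_mul, smul_smul, smul_smul] at h
  refine eq_of_smul_pauli_mem hχ hω hS hc'' ?_ hvw (by simpa [mul_assoc] using h)
  exact mul_ne_zero (mul_ne_zero hc hc') (χ.val_isUnit _).ne_zero

/-- The stabilizer code as an additive subgroup. -/
def psiSubgroup (hω : ω ≠ 0) (hphase : ∀ x, ∃ ℓ : ℤ, χ x = ω ^ ℓ) (hS : IsStabilizer χ ω S) :
    AddSubgroup ((Fin n → ZMod d) × (Fin n → ZMod d)) :=
  let H : AddSubmonoid ((Fin n → ZMod d) × (Fin n → ZMod d)) :=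
    { carrier := PsiIm χ ω S
      zero_mem' := ⟨0, by
        rw [zpow_zero, one_smul]
        have h := hS.2.1
        rwa [← pauli_zero χ] at h⟩
      add_mem' := by
        rintro v w ⟨ℓ, hv⟩ ⟨m, hw⟩
        obtain ⟨k, hk⟩ := hphase (v.2 ⬝ᵥ w.1)
        refine ⟨ℓ + m + k, ?_⟩
        have h := hS.2.2.1 _ hv _ hw
        change ω ^ ℓ • pauli χ v.1 v.2 * ω ^ m • pauli χ w.1 w.2 ∈ S at h
        rw [Matrix.smul_mul, Matrix.mul_smul, pauli_mul, smul_smul, smul_smul, hk,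
          ← zpow_add₀ hω, ← zpow_add₀ hω] at h
        exact h }
  { H with
    neg_mem' := by
      intro v hv
      have hneg : -v = (d - 1) • v := by
        rw [neg_eq_iff_add_eq_zero, ← succ_nsmul', Nat.sub_add_cancel (NeZero.pos d)]
        ext i <;> simp
      rw [hneg]
      exact H.nsmul_mem hv _ }

variable {S' : Set (Matrix (Fin n → ZMod d) (Fin n → ZMod d) ℂ)}

lemma image_monoPair_psiIm (hχ : Function.Injective χ) (hω : ω ≠ 0)
    {Us : Fin n → Matrix (ZMod d) (ZMod d) ℂ} {A : Fin n → Matrix (Fin 2) (Fin 2) (ZMod d)}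
    (hacts : ∀ i, ActsBy χ ω (Us i) (A i)) {σ : Equiv.Perm (Fin n)}
    (h : S' = (fun P => kron Us * P * (kron Us)ᴴ) '' permSet χ ω σ S) :
    monoPair σ A '' PsiIm χ ω S = PsiIm χ ω S' := by
  have hconj := exists_kron_conj_pauli hω hacts σ
  apply Set.Subset.antisymm
  · rintro _ ⟨v, ⟨ℓ, hv⟩, rfl⟩
    obtain ⟨m, hm⟩ := hconj v
    refine ⟨ℓ + m, ?_⟩
    rw [h]
    refine ⟨_, ⟨ℓ, v.1, v.2, hv, rfl⟩, ?_⟩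
    change kron Us * ω ^ ℓ • pauli χ (v.1 ∘ σ) (v.2 ∘ σ) * (kron Us)ᴴ = _
    rw [Matrix.mul_smul, Matrix.smul_mul, hm, smul_smul, zpow_add₀ hω]
    rfl
  · rintro w ⟨m, hw⟩
    rw [h] at hw
    obtain ⟨_, ⟨ℓ, a, b, hv, rfl⟩, hP⟩ := hw
    obtain ⟨k, hk⟩ := hconj (a, b)
    change kron Us * ω ^ ℓ • pauli χ (a ∘ σ) (b ∘ σ) * (kron Us)ᴴ =
      ω ^ m • pauli χ w.1 w.2 at hP
    rw [Matrix.mul_smul, Matrix.smul_mul, hk, smul_smul] at hP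
    obtain ⟨-, h1, h2⟩ := smul_pauli_cancel χ hχ
      (mul_ne_zero (zpow_ne_zero _ hω) (zpow_ne_zero _ hω)) hP
    exact ⟨(a, b), ⟨ℓ, hv⟩, Prod.ext h1 h2⟩

/-- The phase discrepancy between `S'` and a Clifford image of `S` with the same code is removed
by a Pauli operator. -/
lemma exists_pauli_correction (hχ : IsPrimitiveRoot (χ 1) d) (hω : ω ≠ 0)
    (hphase : ∀ x, ∃ ℓ : ℤ, χ x = ω ^ ℓ) (hS : IsStabilizer χ ω S) (hS' : IsStabilizer χ ω S')
    {Us : Fin n → Matrix (ZMod d) (ZMod d) ℂ} (hUs : ∀ i, Us i ∈ unitaryGroup (ZMod d) ℂ)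
    {A : Fin n → Matrix (Fin 2) (Fin 2) (ZMod d)} (hacts : ∀ i, ActsBy χ ω (Us i) (A i))
    {σ : Equiv.Perm (Fin n)} (h : monoPair σ A '' PsiIm χ ω S = PsiIm χ ω S') :
    ∃ p q : Fin n → ZMod d,
      S' = (fun P => kron (fun i => Us i * pauli1 χ (p i) (q i)) * P *
        (kron fun i => Us i * pauli1 χ (p i) (q i))ᴴ) '' permSet χ ω σ S := by
  have hinj := injective_of_isPrimitiveRoot hχ
  have hz : ∀ m : ℤ, ω ^ m ≠ 0 := fun m => zpow_ne_zero m hω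
  choose k hk using exists_kron_conj_pauli hω hacts σ
  have hf' : ∀ v ∈ PsiIm χ ω S, ∃ ℓ : ℤ, ω ^ ℓ • pauli χ v.1 v.2 ∈ S := fun _ hv => hv
  have hg' : ∀ v ∈ PsiIm χ ω S,
      ∃ ℓ : ℤ, ω ^ ℓ • pauli χ (monoPair σ A v).1 (monoPair σ A v).2 ∈ S' :=
    fun _ hv => h.subset ⟨_, hv, rfl⟩
  choose! f hf using hf'
  choose! g hg using hg'
  have hkadd : ∀ v w, χ (v.2 ⬝ᵥ w.1) * ω ^ k (v + w) =
      ω ^ k v * ω ^ k w * χ ((monoPair σ A v).2 ⬝ᵥ (monoPair σ A w).1) := by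
    intro v w
    have hU : (kron Us)ᴴ * kron Us = 1 := by
      rw [conjTranspose_kron, kron_mul, ← kron_one]
      exact congrArg kron (funext fun i => mem_unitaryGroup_iff'.mp (hUs i))
    have h1 := conj_mul_conj hU (pauli χ (v.1 ∘ σ) (v.2 ∘ σ)) (pauli χ (w.1 ∘ σ) (w.2 ∘ σ))
    rw [hk, hk, pauli_mul, comp_equiv_dotProduct_comp_equiv, Matrix.mul_smul, Matrix.smul_mul] at h1
    have h2 := hk (v + w)
    change kron Us * pauli χ (v.1 ∘ σ + w.1 ∘ σ) (v.2 ∘ σ + w.2 ∘ σ) * _ = _ at h2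
    rw [h2, Matrix.smul_mul, Matrix.mul_smul, pauli_mul, smul_smul, smul_smul, smul_smul] at h1
    exact (smul_pauli_cancel χ hinj
      (mul_ne_zero (χ.val_isUnit _).ne_zero (hz _)) h1).1
  let H := psiSubgroup hω hphase hS
  obtain ⟨p, q, hpq⟩ := exists_dotProduct_of_mul hχ H
    (fun v => ω ^ g v * (ω ^ f v * ω ^ k v)⁻¹)
    (fun v _ => mul_ne_zero (hz _) (inv_ne_zero (mul_ne_zero (hz _) (hz _)))) (by
      intro v hv w hw
      have hvw := H.add_mem hv hw
      have h1 := phase_add hinj hω hS (hz _) (hz _) (hz _) (hf v hv) (hf w hw) (hf _ hvw)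
      have h2 := phase_add hinj hω hS' (hz _) (hz _) (hz _) (hg v hv) (hg w hw)
        (by rw [← monoPair_add]; exact hg _ hvw)
      have h3 := hkadd v w
      have e1 := hz (f v)
      have e2 := hz (f w)
      have e3 := hz (k v)
      have e4 := hz (k w)
      have e5 := hz (k (v + w))
      have e6 : χ (v.2 ⬝ᵥ w.1) ≠ 0 := (χ.val_isUnit _).ne_zero
      simp only [h1, h2]
      field_simp
      linear_combination -h3)
  have hconj : ∀ v ∈ PsiIm χ ω S,
      kron (fun i => Us i * pauli1 χ (-q (σ i)) (p (σ i))) *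
        ω ^ f v • pauli χ (v.1 ∘ σ) (v.2 ∘ σ) *
        (kron fun i => Us i * pauli1 χ (-q (σ i)) (p (σ i)))ᴴ =
      ω ^ g v • pauli χ (monoPair σ A v).1 (monoPair σ A v).2 := by
    intro v hv
    have hsplit : (kron fun i => Us i * pauli1 χ (-q (σ i)) (p (σ i))) =
        kron Us * pauli χ ((-q) ∘ σ) (p ∘ σ) := by
      rw [pauli_eq_kron, kron_mul]
      rfl
    rw [hsplit]
    calc kron Us * pauli χ ((-q) ∘ σ) (p ∘ σ) * ω ^ f v • pauli χ (v.1 ∘ σ) (v.2 ∘ σ) *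
          (kron Us * pauli χ ((-q) ∘ σ) (p ∘ σ))ᴴ
        = ω ^ f v • (kron Us * (pauli χ ((-q) ∘ σ) (p ∘ σ) * pauli χ (v.1 ∘ σ) (v.2 ∘ σ) *
            (pauli χ ((-q) ∘ σ) (p ∘ σ))ᴴ) * (kron Us)ᴴ) := by
          simp only [Matrix.conjTranspose_mul, Matrix.mul_assoc, Matrix.mul_smul, Matrix.smul_mul]
      _ = _ := by
          have hdot : p ⬝ᵥ v.1 - v.2 ⬝ᵥ -q = p ⬝ᵥ v.1 + q ⬝ᵥ v.2 := by
            rw [dotProduct_neg, sub_neg_eq_add, dotProduct_comm q]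
          rw [pauli_conj, comp_equiv_dotProduct_comp_equiv, comp_equiv_dotProduct_comp_equiv, hdot,
            ← hpq v hv, Matrix.mul_smul, Matrix.smul_mul, hk, smul_smul, smul_smul]
          congr 1
          have e1 := hz (f v)
          have e2 := hz (k v)
          field_simp
  refine ⟨fun i => -q (σ i), fun i => p (σ i), Set.Subset.antisymm ?_ ?_⟩
  · intro M hM
    obtain ⟨ℓ, a, b, rfl⟩ := hS'.1 hM
    obtain ⟨v, hv, hvab⟩ := h.symm.subset (show (a, b) ∈ PsiIm χ ω S' from ⟨ℓ, hM⟩)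
    refine ⟨_, ⟨f v, v.1, v.2, hf v hv, rfl⟩, (hconj v hv).trans ?_⟩
    have hgv := hg v hv
    rw [hvab] at hgv ⊢
    rw [eq_of_smul_pauli_mem hinj hω hS' (hz _) (hz _) hgv hM]
    rfl
  · rintro _ ⟨_, ⟨ℓ, a, b, hab, rfl⟩, rfl⟩
    have hv : (a, b) ∈ PsiIm χ ω S := ⟨ℓ, hab⟩
    have hℓ : ω ^ ℓ = ω ^ f (a, b) :=
      eq_of_smul_pauli_mem (a := a) (b := b) hinj hω hS (hz _) (hz _) hab (hf _ hv)
    rw [hℓ]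
    have hgv := hg _ hv
    rw [← hconj _ hv] at hgv
    exact hgv

end

end Stabilizer

end Pauli

/-- Over `R = ℤ/dℤ`, two stabilizer codes `C = Ψ(S)` and
`C' = Ψ(S')` are monomially equivalent (some `SL₂(R)`-monomial map carries `C` onto
`C'`) iff the quantum stabilizer codes `Q(S)`, `Q(S')` are LCP equivalent:
`S' = U σ(S) U†` for some permutation `σ ∈ S_n` and local Clifford operator
`U = U₁ ⊗ ⋯ ⊗ U_n`. -/
theorem stmt18 (d : ℕ) [NeZero d] {n : ℕ}
    (χ : AddChar (ZMod d) ℂ)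
    (hχ : ∀ x : ZMod d,
      χ x = Complex.exp (2 * Real.pi * Complex.I * (x.val : ℂ) / (d : ℂ)))
    (ω : ℂ) (hω : IsPrimitiveRoot ω (if d % 2 = 1 then d else 2 * d))
    (S S' : Set (Matrix (Fin n → ZMod d) (Fin n → ZMod d) ℂ))
    (hS : IsStabilizer χ ω S) (hS' : IsStabilizer χ ω S') :
    (∃ (σ : Equiv.Perm (Fin n)) (A : Fin n → Matrix (Fin 2) (Fin 2) (ZMod d)),
        (∀ i, (A i).det = 1) ∧
        monoPair σ A '' PsiIm χ ω S = PsiIm χ ω S') ↔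
    (∃ (σ : Equiv.Perm (Fin n)) (Us : Fin n → Matrix (ZMod d) (ZMod d) ℂ),
        (∀ i, Us i ∈ Matrix.unitaryGroup (ZMod d) ℂ) ∧
        (∀ i, (fun P => Us i * P * (Us i)ᴴ) '' PauliSet1 χ ω = PauliSet1 χ ω) ∧
        S' = (fun P => kron Us * P * (kron Us)ᴴ) '' permSet χ ω σ S) := by
  have hd : d ≠ 0 := NeZero.ne d
  have hχ₁ : IsPrimitiveRoot (χ 1) d := by
    rcases eq_or_ne d 1 with rfl | hd1
    · rw [Subsingleton.elim (1 : ZMod 1) 0, AddChar.map_zero_eq_one]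
      exact IsPrimitiveRoot.one
    · have : Fact (1 < d) := ⟨by omega⟩
      have h := Complex.isPrimitiveRoot_exp d hd
      rwa [hχ, ZMod.val_one, Nat.cast_one, mul_one]
  have hN : (if d % 2 = 1 then d else 2 * d) ≠ 0 := by split_ifs <;> simpa
  have : NeZero (if d % 2 = 1 then d else 2 * d) := ⟨hN⟩
  have hdvd : d ∣ if d % 2 = 1 then d else 2 * d := by
    split_ifs
    exacts [dvd_rfl, dvd_mul_left d 2]
  have hω0 : ω ≠ 0 := hω.ne_zero hN
  have hphase : ∀ x, ∃ ℓ : ℤ, χ x = ω ^ ℓ := by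
    intro x
    obtain ⟨i, -, hi⟩ := hω.eq_pow_of_pow_eq_one ((hχ₁.pow_eq_one_iff_dvd _).mpr hdvd)
    exact ⟨(i * x.val : ℕ), by rw [Pauli.map_eq_pow, ← hi, zpow_natCast, pow_mul]⟩
  constructor
  · rintro ⟨σ, A, hA, h⟩
    choose Us hUs hacts using fun i => Pauli.exists_unitary_actsBy hχ₁ hω hphase (hA i)
    obtain ⟨p, q, hS'eq⟩ := Pauli.exists_pauli_correction hχ₁ hω0 hphase hS hS' hUs hacts h
    exact ⟨σ, fun i => Us i * Pauli.pauli1 χ (p i) (q i),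
      fun i => mul_mem (hUs i) (Pauli.pauli1_mem_unitaryGroup χ _ _),
      fun i => ((hacts i).mul_pauli1 hω0 hphase _ _).image_pauliSet1 hω0 (hA i), hS'eq⟩
  · rintro ⟨σ, Us, hUs, himage, h⟩
    choose A hA hacts using fun i =>
      Pauli.exists_actsBy_of_image hχ₁ hω0 hphase (hUs i) (himage i)
    exact ⟨σ, A, hA, Pauli.image_monoPair_psiIm (Pauli.injective_of_isPrimitiveRoot hχ₁) hω0 hacts h⟩
end

section
/- Let R be a finite commutative ring and let χ and χ' both be generating characters of R. Then χ and χ' differ by a unit: there exists u ∈ R^* such that χ' = u·χ, i.e., χ'(v) = χ(vu) for all v ∈ R. -/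
/-- The kernel of a generating character contains no nonzero principal ideal. -/
theorem IsGenChar.eq_zero_of_forall_apply_mul_eq_one {R : Type*} [CommRing R] [Fintype R]
    {χ : AddChar R ℂ} (hχ : IsGenChar χ) {a : R} (ha : ∀ v : R, χ (v * a) = 1) : a = 0 := by
  refine AddChar.forall_apply_eq_zero.mp fun ψ => ?_
  obtain ⟨r, hr⟩ := hχ ψ
  rw [hr, mul_comm, ha]

/-- Any two generating characters of a finite commutative ring
differ by a unit:  `χ' = u · χ`, i.e. `χ'(v) = χ(v u)` for all `v`. -/
theorem stmt19 {R : Type*} [CommRing R] [Fintype R] (χ χ' : AddChar R ℂ)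
    (hχ : IsGenChar χ) (hχ' : IsGenChar χ') :
    ∃ u : Rˣ, ∀ v : R, χ' v = χ (v * u) := by
  obtain ⟨r, hr⟩ := hχ χ'
  obtain ⟨s, hs⟩ := hχ' χ
  have hsr : s * r - 1 = 0 := by
    refine hχ.eq_zero_of_forall_apply_mul_eq_one fun v => ?_
    rw [mul_sub, mul_one, AddChar.map_sub_eq_div, ← mul_assoc, ← hr, ← hs,
      div_self (χ.val_isUnit v).ne_zero]
  have hrs : r * s = 1 := by rw [mul_comm]; exact sub_eq_zero.mp hsr
  exact ⟨Units.mkOfMulEqOne r s hrs, hr⟩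
end
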